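/- Let X₁ = {(x,y,z) ∈ ℂ³ : (y³ − z²x)(y³ + z²x) + (x+y+z)⁷ = 0} and X₂ = {(x,y,z) ∈ ℂ³ : (y³ − z²x)(y³ + 2z²x) + (x+y+z)⁷ = 0}. Then (X₁,0) and (X₂,0) are superisolated singularities, their projectivized tangent cones C₁ = {(y³ − z²x)(y³ + z²x) = 0} and C₂ = {(y³ − z²x)(y³ + 2z²x) = 0} in ℙ²(ℂ) have the same combinatorial type, but (X₁,0) and (X₂,0) do NOT have the same outer Lipschitz geometry. -/

import Mathlib

open scoped Topology ENNReal

noncomputable section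

/-- `ℂ³` with the Euclidean (Hermitian) norm. -/
abbrev C3 := EuclideanSpace ℂ (Fin 3)

/-- The complex projective plane `ℙ²(ℂ)`. -/
abbrev P2 := Projectivization ℂ (Fin 3 → ℂ)

instance : TopologicalSpace P2 :=
  inferInstanceAs (TopologicalSpace (Quotient (projectivizationSetoid ℂ (Fin 3 → ℂ))))

/-- Nonzero vectors `u ∈ ℂ³` representing singular points of the projective curve
`{f = 0}`: `f(u) = 0` and all three partial derivatives of `f` vanish at `u`. -/
def SingVec (f : MvPolynomial (Fin 3) ℂ) : Set (Fin 3 → ℂ) :=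
  {u | u ≠ 0 ∧ MvPolynomial.eval u f = 0 ∧
    ∀ i : Fin 3, MvPolynomial.eval u (MvPolynomial.pderiv i f) = 0}

/-- `X` is a superisolated surface singularity with equation `f + g = 0`, where `f`, `g`
are homogeneous of degrees `d ≥ 2` and `d+1`, `f` is squarefree, and `{g = 0} ⊆ ℙ²`
contains no singular point of the projectivized tangent cone `{f = 0}`. -/
def IsSIS (X : Set C3) (f g : MvPolynomial (Fin 3) ℂ) (d : ℕ) : Prop :=
  2 ≤ d ∧ f.IsHomogeneous d ∧ g.IsHomogeneous (d + 1) ∧ Squarefree f ∧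
  X = {p : C3 | MvPolynomial.eval (fun i => p i) (f + g) = 0} ∧
  ∀ u ∈ SingVec f, MvPolynomial.eval u g ≠ 0

/-- The zero set in `ℙ²(ℂ)` of a homogeneous polynomial `f ∈ ℂ[x,y,z]`. -/
def projCurve (f : MvPolynomial (Fin 3) ℂ) : Set P2 :=
  {P | MvPolynomial.eval P.rep f = 0}

/-- Two projective plane curves have the same combinatorial type: there are open
neighborhoods `N₁ ⊇ C₁`, `N₂ ⊇ C₂` in `ℙ²(ℂ)` and a homeomorphism `Φ : N₁ → N₂` with
`Φ(C₁) = C₂`. -/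
def SameCombinatorialType (C₁ C₂ : Set P2) : Prop :=
  ∃ Φ : PartialHomeomorph P2 P2, C₁ ⊆ Φ.source ∧ C₂ ⊆ Φ.target ∧ Φ '' C₁ = C₂


/-- The germs at `0` of `X₁, X₂ ⊆ ℂ³` have the same outer Lipschitz geometry. -/
def SameOuterLipschitzGeometry (X₁ X₂ : Set C3) : Prop :=
  ∃ U₁ U₂ : Set C3, IsOpen U₁ ∧ IsOpen U₂ ∧ (0 : C3) ∈ U₁ ∧ (0 : C3) ∈ U₂ ∧
    ∃ φ : (X₁ ∩ U₁ : Set C3) ≃ₜ (X₂ ∩ U₂ : Set C3),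
      (∀ p : (X₁ ∩ U₁ : Set C3), (p : C3) = 0 → (φ p : C3) = 0) ∧
      ∃ K : ℝ, 1 ≤ K ∧ ∀ p q : (X₁ ∩ U₁ : Set C3),
        (1 / K) * ‖(p : C3) - (q : C3)‖ ≤ ‖(φ p : C3) - (φ q : C3)‖ ∧
        ‖(φ p : C3) - (φ q : C3)‖ ≤ K * ‖(p : C3) - (q : C3)‖

open MvPolynomial in
/-- `f₁ = (y³ − z²x)(y³ + z²x)`, with variables `x = X 0`, `y = X 1`, `z = X 2`. -/
def fOne : MvPolynomial (Fin 3) ℂ :=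
  (X 1 ^ 3 - X 2 ^ 2 * X 0) * (X 1 ^ 3 + X 2 ^ 2 * X 0)

open MvPolynomial in
/-- `f₂ = (y³ − z²x)(y³ + 2z²x)`. -/
def fTwo : MvPolynomial (Fin 3) ℂ :=
  (X 1 ^ 3 - X 2 ^ 2 * X 0) * (X 1 ^ 3 + 2 * X 2 ^ 2 * X 0)

open MvPolynomial in
/-- `g = (x+y+z)⁷`. -/
def gSeven : MvPolynomial (Fin 3) ℂ := (X 0 + X 1 + X 2) ^ 7

/-- `X₁ = {(y³ − z²x)(y³ + z²x) + (x+y+z)⁷ = 0}`. -/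
def XOne : Set C3 :=
  {p : C3 | MvPolynomial.eval (fun i => p i) (fOne + gSeven) = 0}

/-- `X₂ = {(y³ − z²x)(y³ + 2z²x) + (x+y+z)⁷ = 0}`. -/
def XTwo : Set C3 :=
  {p : C3 | MvPolynomial.eval (fun i => p i) (fTwo + gSeven) = 0}

open MvPolynomial in
lemma hom_fOne : fOne.IsHomogeneous 6 := by
  have h1 : (X 1 ^ 3 : MvPolynomial (Fin 3) ℂ).IsHomogeneous 3 := by
    simpa using (isHomogeneous_X ℂ (1 : Fin 3)).pow 3
  have h2 : (X 2 ^ 2 * X 0 : MvPolynomial (Fin 3) ℂ).IsHomogeneous 3 := by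
    simpa using ((isHomogeneous_X ℂ (2 : Fin 3)).pow 2).mul (isHomogeneous_X ℂ (0 : Fin 3))
  exact (h1.sub h2).mul (h1.add h2)

open MvPolynomial in
lemma hom_fTwo : fTwo.IsHomogeneous 6 := by
  have h1 : (X 1 ^ 3 : MvPolynomial (Fin 3) ℂ).IsHomogeneous 3 := by
    simpa using (isHomogeneous_X ℂ (1 : Fin 3)).pow 3
  have h2 : (X 2 ^ 2 * X 0 : MvPolynomial (Fin 3) ℂ).IsHomogeneous 3 := by
    simpa using ((isHomogeneous_X ℂ (2 : Fin 3)).pow 2).mul (isHomogeneous_X ℂ (0 : Fin 3))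
  have h3 : (2 * X 2 ^ 2 * X 0 : MvPolynomial (Fin 3) ℂ).IsHomogeneous 3 := by
    have := h2.add h2
    convert this using 1
    ring
  exact (h1.sub h2).mul (h1.add h3)

open MvPolynomial in
lemma hom_gSeven : gSeven.IsHomogeneous 7 := by
  have := (((isHomogeneous_X ℂ (0 : Fin 3)).add (isHomogeneous_X ℂ (1 : Fin 3))).add
    (isHomogeneous_X ℂ (2 : Fin 3))).pow 7
  simpa [gSeven] using this

open MvPolynomial in
lemma dvd_pderiv_of_sq {h f : MvPolynomial (Fin 3) ℂ} (hf : h * h ∣ f) (i : Fin 3) :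
    h ∣ pderiv i f := by
  obtain ⟨k, rfl⟩ := hf
  simp only [Derivation.leibniz, smul_eq_mul]
  refine dvd_add ⟨h * pderiv i k, by ring⟩ ⟨k * (pderiv i h + pderiv i h), by ring⟩

open MvPolynomial in
lemma not_X_dvd {i : Fin 3} {f : MvPolynomial (Fin 3) ℂ} (u : Fin 3 → ℂ) (hu : u i = 0)
    (h : eval u f ≠ 0) : ¬ X i ∣ f := by
  rintro ⟨k, rfl⟩
  simp [hu] at h

open MvPolynomial in
lemma relprime_X {i : Fin 3} {f : MvPolynomial (Fin 3) ℂ} (hf : ¬ X i ∣ f) :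
    IsRelPrime f (X i) := by
  have : Irreducible (X i : MvPolynomial (Fin 3) ℂ) := (X_prime (i := i)).irreducible
  exact ((this.isRelPrime_iff_not_dvd).2 hf).symm

open MvPolynomial in
lemma unit_of_dvd_ab {h : MvPolynomial (Fin 3) ℂ} (h1 : h ∣ X 1 ^ 3) (h2 : h ∣ X 2 ^ 2 * X 0) :
    IsUnit h := by
  have : IsRelPrime (X 2 ^ 2 * X 0 : MvPolynomial (Fin 3) ℂ) (X 1) :=
    relprime_X (not_X_dvd ![1, 0, 1] (by simp) (by simp))
  exact (this.pow_right (n := 3)) h2 h1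

open MvPolynomial in
lemma pderiv_two (i : Fin 3) : pderiv i (2 : MvPolynomial (Fin 3) ℂ) = 0 := by
  rw [show (2 : MvPolynomial (Fin 3) ℂ) = C 2 from rfl, pderiv_C]

open MvPolynomial in
lemma sqf_fOne : Squarefree fOne := by
  intro h hh
  have hf : h ∣ fOne := (Dvd.intro _ rfl).trans hh
  have e1 : pderiv 1 fOne = C 6 * X 1 ^ 5 := by
    rw [show (C 6 : MvPolynomial (Fin 3) ℂ) = 6 from rfl]
    simp [fOne, pderiv_X]
    ring
  have h1 := dvd_pderiv_of_sq hh 1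
  rw [e1] at h1
  have r1 : IsRelPrime fOne (X 1) :=
    relprime_X (not_X_dvd ![1, 0, 1] (by simp) (by simp [fOne]))
  have r2 : IsRelPrime h (X 1 ^ 5) := (r1.of_dvd_left hf).pow_right
  have h2 : h ∣ C 6 := r2.dvd_of_dvd_mul_right h1
  exact isUnit_of_dvd_unit h2 ((isUnit_iff_ne_zero.2 (by norm_num : (6 : ℂ) ≠ 0)).map C)

open MvPolynomial in
lemma sqf_fTwo : Squarefree fTwo := by
  intro h hh
  have hf : h ∣ fTwo := (Dvd.intro _ rfl).trans hh
  have e1 : pderiv 1 fTwo = (6 * X 1 ^ 3 + 3 * (X 2 ^ 2 * X 0)) * X 1 ^ 2 := by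
    simp [fTwo, pderiv_X, pderiv_two]
    ring
  have e0 : pderiv 0 fTwo = (X 1 ^ 3 - 4 * (X 2 ^ 2 * X 0)) * X 2 ^ 2 := by
    simp [fTwo, pderiv_X, pderiv_two]
    ring
  have h1 := dvd_pderiv_of_sq hh 1
  have h0 := dvd_pderiv_of_sq hh 0
  rw [e1] at h1
  rw [e0] at h0
  have r1 : IsRelPrime fTwo (X 1) :=
    relprime_X (not_X_dvd ![1, 0, 1] (by simp) (by simp [fTwo]))
  have r2 : IsRelPrime fTwo (X 2) :=
    relprime_X (not_X_dvd ![1, 1, 0] (by simp) (by simp [fTwo]))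
  have h1' := ((r1.of_dvd_left hf).pow_right (n := 2)).dvd_of_dvd_mul_right h1
  have h0' := ((r2.of_dvd_left hf).pow_right (n := 2)).dvd_of_dvd_mul_right h0
  have c27 : (C (1/27) : MvPolynomial (Fin 3) ℂ) * 27 = 1 := by
    rw [show (27 : MvPolynomial (Fin 3) ℂ) = C 27 from rfl, ← C_mul]; norm_num
  refine unit_of_dvd_ab ?_ ?_
  · have : (X 1 ^ 3 : MvPolynomial (Fin 3) ℂ) = C (1/27) * (4 * (6 * X 1 ^ 3 + 3 * (X 2 ^ 2 * X 0))
        + 3 * (X 1 ^ 3 - 4 * (X 2 ^ 2 * X 0))) := by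
      linear_combination (- X 1 ^ 3) * c27
    rw [this]
    exact Dvd.dvd.mul_left (dvd_add (h1'.mul_left _) (h0'.mul_left _)) _
  · have : (X 2 ^ 2 * X 0 : MvPolynomial (Fin 3) ℂ) =
        C (1/27) * ((6 * X 1 ^ 3 + 3 * (X 2 ^ 2 * X 0))
        - 6 * (X 1 ^ 3 - 4 * (X 2 ^ 2 * X 0))) := by
      linear_combination (- (X 2 ^ 2 * X 0)) * c27
    rw [this]
    exact Dvd.dvd.mul_left (dvd_sub h1' (h0'.mul_left _)) _

open MvPolynomial in
lemma sis_one : IsSIS XOne fOne gSeven 6 := by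
  refine ⟨by norm_num, hom_fOne, hom_gSeven, sqf_fOne, rfl, ?_⟩
  rintro u ⟨hu, hf, hd⟩
  have h0 := hd 0
  have h1 := hd 1
  simp [fOne, pderiv_X] at h0 h1 hf
  have y0 : u 1 = 0 := by
    have : u 1 ^ 5 = 0 := by linear_combination (1/6) * h1
    simpa using this
  have : u 2 = 0 ∨ u 0 = 0 := by
    have : u 2 ^ 4 * u 0 = 0 := by rw [y0] at h0; linear_combination (-1/2) * h0
    simpa using this
  rcases this with h | h
  · simp [gSeven, y0, h]
    intro h'; apply hu; ext i; fin_cases i <;> simp [*]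
  · simp [gSeven, y0, h]
    intro h'; apply hu; ext i; fin_cases i <;> simp [*]

open MvPolynomial in
lemma sis_two : IsSIS XTwo fTwo gSeven 6 := by
  refine ⟨by norm_num, hom_fTwo, hom_gSeven, sqf_fTwo, rfl, ?_⟩
  rintro u ⟨hu, hf, hd⟩
  have h0 := hd 0
  have h1 := hd 1
  have h2 := hd 2
  simp [fTwo, pderiv_X, pderiv_two] at h0 h1 h2 hf
  have y0 : u 1 = 0 := by
    by_contra hy
    have e1 : 2 * u 1 ^ 3 + u 2 ^ 2 * u 0 = 0 := by
      have : u 1 ^ 2 * (2 * u 1 ^ 3 + u 2 ^ 2 * u 0) = 0 := by linear_combination (1/3) * h1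
      simpa [hy] using this
    have e2 : u 1 ^ 6 = 0 := by
      rcases hf with hf | hf
      · linear_combination (1/3) * u 1 ^ 3 * (e1 + hf)
      · linear_combination (1/3) * u 1 ^ 3 * (2 * e1 - hf)
    simp [hy] at e2
  have : u 2 = 0 ∨ u 0 = 0 := by
    have : u 2 ^ 4 * u 0 = 0 := by rw [y0] at h0; linear_combination (-1/4) * h0
    simpa using this
  rcases this with h | h
  · simp [gSeven, y0, h]
    intro h'; apply hu; ext i; fin_cases i <;> simp [*]
  · simp [gSeven, y0, h]
    intro h'; apply hu; ext i; fin_cases i <;> simp [*]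

def cc : ℝ := (2 : ℝ) ^ (1 / 3 : ℝ) - 1
lemma cc_cube : (1 + cc) ^ 3 = 2 := by
  unfold cc
  rw [add_sub_cancel, ← Real.rpow_natCast, ← Real.rpow_mul (by norm_num)]
  norm_num
lemma cc_pos : 0 < cc := by
  unfold cc
  have : (1 : ℝ) < (2 : ℝ) ^ (1 / 3 : ℝ) := Real.one_lt_rpow (by norm_num) (by norm_num)
  linarith

/-- angular parameter -/
def kk (y b : ℂ) : ℝ := (1 - (y ^ 3 * (starRingEnd ℂ) b).re / (‖y‖ ^ 3 * ‖b‖)) / 2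

lemma kk_nonneg (y b : ℂ) : 0 ≤ kk y b := by
  unfold kk
  have : (y ^ 3 * (starRingEnd ℂ) b).re / (‖y‖ ^ 3 * ‖b‖) ≤ 1 := by
    apply div_le_one_of_le₀ _ (by positivity)
    refine (Complex.re_le_norm _).trans (by simp)
  linarith
lemma kk_le (y b : ℂ) : kk y b ≤ 1 := by
  unfold kk
  have : -1 ≤ (y ^ 3 * (starRingEnd ℂ) b).re / (‖y‖ ^ 3 * ‖b‖) := by
    rw [← neg_le_neg_iff, ← neg_div]
    simp only [neg_neg]
    apply div_le_one_of_le₀ _ (by positivity)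
    rw [← Complex.neg_re]
    refine (Complex.re_le_norm _).trans (by simp)
  linarith
lemma kk_smul {l : ℂ} (hl : l ≠ 0) (y b : ℂ) : kk (l * y) (l ^ 3 * b) = kk y b := by
  unfold kk
  have e : (l * y) ^ 3 * (starRingEnd ℂ) (l ^ 3 * b)
      = ((‖l‖ ^ 6 : ℝ) : ℂ) * (y ^ 3 * (starRingEnd ℂ) b) := by
    have : l * (starRingEnd ℂ) l = ((‖l‖ ^ 2 : ℝ) : ℂ) := by
      rw [Complex.mul_conj, Complex.normSq_eq_norm_sq]
    calc _ = (l * (starRingEnd ℂ) l) ^ 3 * (y ^ 3 * (starRingEnd ℂ) b) := by simp; ring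
      _ = _ := by rw [this]; push_cast; ring
  rw [e, Complex.re_ofReal_mul]
  have : ‖l‖ ≠ 0 := by simpa using hl
  simp only [norm_mul, norm_pow]
  rw [show (‖l‖ * ‖y‖) ^ 3 * (‖l‖ ^ 3 * ‖b‖) = ‖l‖ ^ 6 * (‖y‖ ^ 3 * ‖b‖) by ring,
    mul_div_mul_left _ _ (by positivity)]
lemma kk_real {r : ℝ} (hr : 0 < r) (y b : ℂ) : kk (r * y) b = kk y b := by
  unfold kk
  have e : ((r : ℂ) * y) ^ 3 * (starRingEnd ℂ) b
      = ((r ^ 3 : ℝ) : ℂ) * (y ^ 3 * (starRingEnd ℂ) b) := by push_cast; ring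
  rw [e, Complex.re_ofReal_mul]
  simp only [norm_mul, Complex.norm_real, Real.norm_eq_abs, abs_of_pos hr]
  rw [show (r * ‖y‖) ^ 3 * ‖b‖ = r ^ 3 * (‖y‖ ^ 3 * ‖b‖) by ring,
    mul_div_mul_left _ _ (by positivity)]

def mm (y b : ℂ) : ℝ := ‖b‖ ^ (1 / 3 : ℝ) / ‖y‖
lemma mm_nonneg (y b : ℂ) : 0 ≤ mm y b := by unfold mm; positivity
lemma mm_smul {l : ℂ} (hl : l ≠ 0) (y b : ℂ) : mm (l * y) (l ^ 3 * b) = mm y b := by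
  unfold mm
  have : ‖l‖ ≠ 0 := by simpa using hl
  simp only [norm_mul, norm_pow]
  rw [Real.mul_rpow (by positivity) (by positivity), ← Real.rpow_natCast,
    ← Real.rpow_mul (by positivity)]
  norm_num
  rw [mul_div_mul_left _ _ this]
lemma mm_real {r : ℝ} (hr : 0 < r) (y b : ℂ) : mm (r * y) b = mm y b / r := by
  unfold mm
  simp only [norm_mul, Complex.norm_real, Real.norm_eq_abs, abs_of_pos hr]
  rw [div_div, mul_comm]

def AA (y b : ℂ) : ℝ := 1 + cc * kk y b * min 1 (mm y b)
def BB (y b : ℂ) : ℝ := 1 - min (cc * kk y b * mm y b) (cc * kk y b / (1 + cc * kk y b))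

lemma ck_nonneg (y b : ℂ) : 0 ≤ cc * kk y b := mul_nonneg cc_pos.le (kk_nonneg _ _)
lemma AA_pos (y b : ℂ) : 0 < AA y b := by
  have := ck_nonneg y b
  have := mm_nonneg y b
  unfold AA; positivity
lemma BB_pos (y b : ℂ) : 0 < BB y b := by
  have := ck_nonneg y b
  have h : cc * kk y b / (1 + cc * kk y b) < 1 := by rw [div_lt_one (by positivity)]; linarith
  have := min_le_right (cc * kk y b * mm y b) (cc * kk y b / (1 + cc * kk y b))
  unfold BB; linarith

lemma AA_BB (y b : ℂ) : AA (BB y b * y) b * BB y b = 1 := by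
  have hB := BB_pos y b
  unfold AA
  rw [kk_real hB, mm_real hB]
  unfold BB at *
  set κ := cc * kk y b
  have hκ : 0 ≤ κ := ck_nonneg y b
  set m := mm y b
  rcases le_total (κ * m) (κ / (1 + κ)) with h | h
  · rw [min_eq_left h] at *
    rcases hκ.eq_or_lt with h0 | h0
    · simp [← h0]
    have hm : m ≤ 1 / (1 + κ) := by
      rw [div_eq_mul_one_div] at h
      exact le_of_mul_le_mul_left h h0
    have hm' : m / (1 - κ * m) ≤ 1 := by
      rw [div_le_one hB]; rw [le_div_iff₀ (by positivity)] at hm; linarith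
    rw [min_eq_right hm']
    field_simp
    ring
  · rw [min_eq_right h] at *
    rcases hκ.eq_or_lt with h0 | h0
    · simp [← h0]
    have hm : 1 / (1 + κ) ≤ m := by
      rw [div_eq_mul_one_div] at h
      exact le_of_mul_le_mul_left h h0
    have e : 1 - κ / (1 + κ) = 1 / (1 + κ) := by field_simp; ring
    rw [e] at hB ⊢
    have hm' : 1 ≤ m / (1 / (1 + κ)) := by
      rwa [le_div_iff₀ hB, one_mul]
    rw [min_eq_left hm']
    field_simp

lemma BB_AA (y b : ℂ) : BB (AA y b * y) b * AA y b = 1 := by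
  have hB := AA_pos y b
  unfold BB
  rw [kk_real hB, mm_real hB]
  unfold AA at *
  set κ := cc * kk y b
  have hκ : 0 ≤ κ := ck_nonneg y b
  have hm := mm_nonneg y b
  set m := mm y b
  rcases le_total 1 m with h | h
  · rw [min_eq_left h] at *
    rw [mul_one] at *
    have : κ / (1 + κ) ≤ κ * (m / (1 + κ)) := by
      rw [mul_div_assoc']
      gcongr
      nlinarith
    rw [min_eq_right this]
    field_simp
    ring
  · rw [min_eq_right h] at *
    have : κ * (m / (1 + κ * m)) ≤ κ / (1 + κ) := by
      rw [mul_div_assoc', div_le_div_iff₀ (by positivity) (by positivity)]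
      nlinarith
    rw [min_eq_left this]
    field_simp
    ring

lemma cont_aux {G : (Fin 3 → ℂ) → ℝ} {D : ℝ}
    (h1 : ∀ v, |G v| ≤ D) (h2 : ∀ v, |G v| ≤ D * mm (v 1) (v 2 ^ 2 * v 0))
    (h3 : ∀ v : Fin 3 → ℂ, v 1 ≠ 0 → v 2 ^ 2 * v 0 ≠ 0 → ContinuousAt G v) :
    Continuous (fun v : Fin 3 → ℂ => (G v : ℂ) * v 1) := by
  rw [continuous_iff_continuousAt]
  intro v
  by_cases hv1 : v 1 = 0
  · have e : (G v : ℂ) * v 1 = 0 := by simp [hv1]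
    unfold ContinuousAt
    beta_reduce
    rw [e]
    apply squeeze_zero_norm (a := fun v : Fin 3 → ℂ => D * ‖v 1‖)
    · intro u
      rw [norm_mul, Complex.norm_real, Real.norm_eq_abs]
      gcongr
      exact h1 u
    · have : Continuous fun v : Fin 3 → ℂ => D * ‖v 1‖ := by fun_prop
      have := this.tendsto v
      simpa [hv1] using this
  by_cases hb : v 2 ^ 2 * v 0 = 0
  · have hG : G v = 0 := by
      have := h2 v
      rw [hb] at this
      simpa [mm] using this
    have e : (G v : ℂ) * v 1 = 0 := by simp [hG]
    unfold ContinuousAt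
    beta_reduce
    rw [e]
    have hD : 0 ≤ D := (abs_nonneg _).trans (h1 v)
    apply squeeze_zero_norm (a := fun v : Fin 3 → ℂ => D * ‖v 2 ^ 2 * v 0‖ ^ (1 / 3 : ℝ))
    · intro u
      rw [norm_mul, Complex.norm_real, Real.norm_eq_abs]
      by_cases hu : u 1 = 0
      · simp only [hu, norm_zero, mul_zero]; positivity
      have hu' : ‖u 1‖ ≠ 0 := by simpa using hu
      calc |G u| * ‖u 1‖ ≤ D * mm (u 1) (u 2 ^ 2 * u 0) * ‖u 1‖ := by gcongr; exact h2 u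
        _ = _ := by unfold mm; field_simp
    · have : Continuous fun v : Fin 3 → ℂ => D * ‖v 2 ^ 2 * v 0‖ ^ (1 / 3 : ℝ) := by
        apply Continuous.mul continuous_const
        apply Continuous.rpow_const
        · fun_prop
        · intro x; right; norm_num
      have := this.tendsto v
      rw [hb] at this
      simpa using this
  · have := h3 v hv1 hb
    have h4 : ContinuousAt (fun v => (G v : ℂ)) v := Complex.continuous_ofReal.continuousAt.comp this
    exact h4.mul (continuous_apply 1).continuousAt

lemma contAt_kk (v : Fin 3 → ℂ) (h1 : v 1 ≠ 0) (h2 : v 2 ^ 2 * v 0 ≠ 0) :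
    ContinuousAt (fun v : Fin 3 → ℂ => kk (v 1) (v 2 ^ 2 * v 0)) v := by
  unfold kk
  refine ContinuousAt.div_const (ContinuousAt.sub continuousAt_const (ContinuousAt.div ?_ ?_ ?_)) _
  · apply Continuous.continuousAt
    apply Complex.continuous_re.comp
    have := Complex.continuous_conj
    fun_prop
  · fun_prop
  · have := norm_ne_zero_iff.2 h1
    have := norm_ne_zero_iff.2 h2
    positivity
lemma contAt_mm (v : Fin 3 → ℂ) (h1 : v 1 ≠ 0) :
    ContinuousAt (fun v : Fin 3 → ℂ => mm (v 1) (v 2 ^ 2 * v 0)) v := by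
  unfold mm
  refine ContinuousAt.div ?_ (continuous_apply 1).norm.continuousAt (norm_ne_zero_iff.2 h1)
  apply Continuous.continuousAt
  apply Continuous.rpow_const
  · fun_prop
  · intro x; right; norm_num

lemma cont_A : Continuous (fun v : Fin 3 → ℂ => (AA (v 1) (v 2 ^ 2 * v 0) : ℂ) * v 1) := by
  have : Continuous (fun v : Fin 3 → ℂ =>
      ((cc * kk (v 1) (v 2 ^ 2 * v 0) * min 1 (mm (v 1) (v 2 ^ 2 * v 0)) : ℝ) : ℂ) * v 1) := by
    have hb : ∀ v : Fin 3 → ℂ, cc * kk (v 1) (v 2 ^ 2 * v 0) ≤ cc := fun v => by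
      nlinarith [kk_le (v 1) (v 2 ^ 2 * v 0), cc_pos]
    have hn : ∀ v : Fin 3 → ℂ, 0 ≤ min 1 (mm (v 1) (v 2 ^ 2 * v 0)) :=
      fun v => le_min (by norm_num) (mm_nonneg _ _)
    refine cont_aux (D := cc) ?_ ?_ ?_
    · intro v
      rw [abs_of_nonneg (mul_nonneg (ck_nonneg _ _) (hn v))]
      calc _ ≤ cc * 1 := mul_le_mul (hb v) (min_le_left _ _) (hn v) cc_pos.le
        _ = cc := mul_one _
    · intro v
      rw [abs_of_nonneg (mul_nonneg (ck_nonneg _ _) (hn v))]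
      exact mul_le_mul (hb v) (min_le_right _ _) (hn v) cc_pos.le
    · intro v h1 h2
      exact (continuousAt_const.mul (contAt_kk v h1 h2)).mul
        (continuousAt_const.min (contAt_mm v h1))
  have h2 : Continuous fun v : Fin 3 → ℂ => v 1 := by fun_prop
  convert h2.add this using 2
  unfold AA
  simp only [Pi.add_apply]
  push_cast
  ring

lemma cont_B : Continuous (fun v : Fin 3 → ℂ => (BB (v 1) (v 2 ^ 2 * v 0) : ℂ) * v 1) := by
  have : Continuous (fun v : Fin 3 → ℂ =>
      ((min (cc * kk (v 1) (v 2 ^ 2 * v 0) * mm (v 1) (v 2 ^ 2 * v 0))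
       (cc * kk (v 1) (v 2 ^ 2 * v 0) / (1 + cc * kk (v 1) (v 2 ^ 2 * v 0))) : ℝ) : ℂ) * v 1) := by
    have hb : ∀ v : Fin 3 → ℂ, cc * kk (v 1) (v 2 ^ 2 * v 0) ≤ cc := fun v => by
      nlinarith [kk_le (v 1) (v 2 ^ 2 * v 0), cc_pos]
    have hn : ∀ v : Fin 3 → ℂ, 0 ≤ min (cc * kk (v 1) (v 2 ^ 2 * v 0) * mm (v 1) (v 2 ^ 2 * v 0))
       (cc * kk (v 1) (v 2 ^ 2 * v 0) / (1 + cc * kk (v 1) (v 2 ^ 2 * v 0))) := fun v => by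
      have h1 := ck_nonneg (v 1) (v 2 ^ 2 * v 0)
      have h2 := mm_nonneg (v 1) (v 2 ^ 2 * v 0)
      apply le_min <;> positivity
    refine cont_aux (D := cc) ?_ ?_ ?_
    · intro v
      rw [abs_of_nonneg (hn v)]
      refine (min_le_right _ _).trans ((div_le_self (ck_nonneg _ _) ?_).trans (hb v))
      linarith [ck_nonneg (v 1) (v 2 ^ 2 * v 0)]
    · intro v
      rw [abs_of_nonneg (hn v)]
      refine (min_le_left _ _).trans ?_
      exact mul_le_mul_of_nonneg_right (hb v) (mm_nonneg _ _)
    · intro v h1 h2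
      have hk := (continuousAt_const (y := cc)).mul (contAt_kk v h1 h2)
      refine (hk.mul (contAt_mm v h1)).min (hk.div (continuousAt_const.add hk) ?_)
      have := ck_nonneg (v 1) (v 2 ^ 2 * v 0)
      positivity
  have h2 : Continuous fun v : Fin 3 → ℂ => v 1 := by fun_prop
  convert h2.sub this using 2
  unfold BB
  simp only [Pi.sub_apply]
  push_cast
  ring

def scal (g : ℂ → ℂ → ℝ) (v : Fin 3 → ℂ) : Fin 3 → ℂ :=
  ![v 0, (g (v 1) (v 2 ^ 2 * v 0) : ℂ) * v 1, v 2]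

lemma scal_ne {g : ℂ → ℂ → ℝ} (hg : ∀ y b, 0 < g y b) {v : Fin 3 → ℂ} (hv : v ≠ 0) :
    scal g v ≠ 0 := by
  intro h
  apply hv
  have h0 := congrFun h 0
  have h1 := congrFun h 1
  have h2 := congrFun h 2
  have := (hg (v 1) (v 2 ^ 2 * v 0)).ne'
  simp [scal, this] at h0 h1 h2
  ext i
  fin_cases i <;> simp [*]

lemma scal_smul {g : ℂ → ℂ → ℝ} (hg : ∀ l y b : ℂ, l ≠ 0 → g (l * y) (l ^ 3 * b) = g y b)
    {l : ℂ} (hl : l ≠ 0) (v : Fin 3 → ℂ) : scal g (l • v) = l • scal g v := by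
  have e : g (l * v 1) ((l * v 2) ^ 2 * (l * v 0)) = g (v 1) (v 2 ^ 2 * v 0) := by
    rw [← hg l (v 1) _ hl]; congr 1; ring
  ext i
  fin_cases i
  · simp [scal]
  · simp [scal, e]; ring
  · simp [scal]

lemma mk_eq_of_smul {v w : Fin 3 → ℂ} (hv : v ≠ 0) (hw : w ≠ 0) {l : ℂ} (h : l • w = v) :
    Projectivization.mk ℂ v hv = Projectivization.mk ℂ w hw :=
  (Projectivization.mk_eq_mk_iff' ℂ v w hv hw).2 ⟨l, h⟩

def scalP (g : ℂ → ℂ → ℝ) (hg : ∀ y b, 0 < g y b)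
    (hg' : ∀ l y b : ℂ, l ≠ 0 → g (l * y) (l ^ 3 * b) = g y b) : P2 → P2 :=
  Projectivization.lift (fun v : {v : Fin 3 → ℂ // v ≠ 0} =>
    Projectivization.mk ℂ (scal g v.1) (scal_ne hg v.2)) (by
      intro a b t h
      have ht : t ≠ 0 := by rintro rfl; exact a.2 (by simp [h])
      apply mk_eq_of_smul _ _ (l := t)
      rw [h, scal_smul hg' ht])

lemma scalP_mk {g : ℂ → ℂ → ℝ} (hg : ∀ y b, 0 < g y b)
    (hg' : ∀ l y b : ℂ, l ≠ 0 → g (l * y) (l ^ 3 * b) = g y b) (v : Fin 3 → ℂ) (hv : v ≠ 0) :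
    scalP g hg hg' (Projectivization.mk ℂ v hv) =
      Projectivization.mk ℂ (scal g v) (scal_ne hg hv) := rfl

lemma cont_scalP {g : ℂ → ℂ → ℝ} (hg : ∀ y b, 0 < g y b)
    (hg' : ∀ l y b : ℂ, l ≠ 0 → g (l * y) (l ^ 3 * b) = g y b)
    (hc : Continuous (fun v : Fin 3 → ℂ => (g (v 1) (v 2 ^ 2 * v 0) : ℂ) * v 1)) :
    Continuous (scalP g hg hg') := by
  have hs : Continuous (scal g) := by
    apply continuous_pi
    intro i
    fin_cases i
    · exact continuous_apply 0
    · exact hc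
    · exact continuous_apply 2
  have h1 : Continuous (fun v : {v : Fin 3 → ℂ // v ≠ 0} =>
      (⟨scal g v.1, scal_ne hg v.2⟩ : {v : Fin 3 → ℂ // v ≠ 0})) :=
    (hs.comp continuous_subtype_val).subtype_mk _
  have h2 : Continuous (fun v : {v : Fin 3 → ℂ // v ≠ 0} => (Projectivization.mk' ℂ v : P2)) :=
    continuous_quot_mk
  exact continuous_quot_lift _ (h2.comp h1)

lemma scal_comp {g h : ℂ → ℂ → ℝ} (e : ∀ y b : ℂ, g (h y b * y) b * h y b = 1) (v : Fin 3 → ℂ) :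
    scal g (scal h v) = v := by
  ext i
  fin_cases i
  · simp [scal]
  · have := congrArg (fun r : ℝ => (r : ℂ)) (e (v 1) (v 2 ^ 2 * v 0))
    simp [scal]
    push_cast at this
    linear_combination (v 1) * this
  · simp [scal]

lemma AA_smul (l y b : ℂ) (hl : l ≠ 0) : AA (l * y) (l ^ 3 * b) = AA y b := by
  unfold AA; rw [kk_smul hl, mm_smul hl]
lemma BB_smul (l y b : ℂ) (hl : l ≠ 0) : BB (l * y) (l ^ 3 * b) = BB y b := by
  unfold BB; rw [kk_smul hl, mm_smul hl]

def phiP : P2 ≃ₜ P2 where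
  toFun := scalP AA AA_pos AA_smul
  invFun := scalP BB BB_pos BB_smul
  left_inv := by
    intro P
    induction P using Projectivization.ind with
    | h v hv =>
      simp only [scalP_mk, scal_comp BB_AA]
  right_inv := by
    intro P
    induction P using Projectivization.ind with
    | h v hv =>
      simp only [scalP_mk, scal_comp AA_BB]
  continuous_toFun := cont_scalP _ _ cont_A
  continuous_invFun := cont_scalP _ _ cont_B

lemma mem_projCurve {f : MvPolynomial (Fin 3) ℂ} 
    (hf : ∀ (a : ℂ) (v : Fin 3 → ℂ), MvPolynomial.eval (a • v) f = a ^ 6 * MvPolynomial.eval v f)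
    (v : Fin 3 → ℂ) (hv : v ≠ 0) :
    Projectivization.mk ℂ v hv ∈ projCurve f ↔ MvPolynomial.eval v f = 0 := by
  obtain ⟨a, ha⟩ := Projectivization.exists_smul_eq_mk_rep ℂ v hv
  unfold projCurve
  rw [Set.mem_ofPred_eq, ← ha]
  have : (a • v : Fin 3 → ℂ) = (a : ℂ) • v := rfl
  rw [this]
  rw [hf]
  simp

lemma kk_pos_mul {y b : ℂ} {r : ℝ} (hb : b ≠ 0) (hr : 0 < r) (h : y ^ 3 = r * b) : kk y b = 0 := by
  unfold kk
  have h2 : ‖y‖ ^ 3 = r * ‖b‖ := by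
    rw [← norm_pow, h]; simp [abs_of_pos hr]
  have hb' := norm_ne_zero_iff.2 hb
  rw [h2, h, mul_assoc, Complex.mul_conj, Complex.normSq_eq_norm_sq, ← Complex.ofReal_mul,
    Complex.ofReal_re]
  field_simp
  ring
lemma kk_neg_mul {y b : ℂ} {r : ℝ} (hb : b ≠ 0) (hr : 0 < r) (h : y ^ 3 = -(r * b)) :
    kk y b = 1 := by
  unfold kk
  have h2 : ‖y‖ ^ 3 = r * ‖b‖ := by
    rw [← norm_pow, h]; simp [abs_of_pos hr]
  have hb' := norm_ne_zero_iff.2 hb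
  rw [h2, h, neg_mul, mul_assoc, Complex.mul_conj, Complex.normSq_eq_norm_sq, ← Complex.ofReal_mul,
    Complex.neg_re, Complex.ofReal_re]
  field_simp
  ring

lemma mm_cube {y b : ℂ} (hy : y ≠ 0) {s : ℝ} (hs : 0 < s) (h : ‖y‖ ^ 3 = s ^ 3 * ‖b‖) :
    mm y b = 1 / s := by
  unfold mm
  have h1 : ‖b‖ = (‖y‖ / s) ^ 3 := by field_simp; linarith
  have hy' := norm_ne_zero_iff.2 hy
  rw [h1, ← Real.rpow_natCast, ← Real.rpow_mul (by positivity)]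
  norm_num
  field_simp

lemma eval_fOne (v : Fin 3 → ℂ) : MvPolynomial.eval v fOne =
    (v 1 ^ 3 - v 2 ^ 2 * v 0) * (v 1 ^ 3 + v 2 ^ 2 * v 0) := by simp [fOne]
lemma eval_fTwo (v : Fin 3 → ℂ) : MvPolynomial.eval v fTwo =
    (v 1 ^ 3 - v 2 ^ 2 * v 0) * (v 1 ^ 3 + 2 * (v 2 ^ 2 * v 0)) := by
  simp [fTwo]; left; ring

lemma hs_fOne (a : ℂ) (v : Fin 3 → ℂ) :
    MvPolynomial.eval (a • v) fOne = a ^ 6 * MvPolynomial.eval v fOne := by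
  simp only [eval_fOne, Pi.smul_apply, smul_eq_mul]; ring
lemma hs_fTwo (a : ℂ) (v : Fin 3 → ℂ) :
    MvPolynomial.eval (a • v) fTwo = a ^ 6 * MvPolynomial.eval v fTwo := by
  simp only [eval_fTwo, Pi.smul_apply, smul_eq_mul]; ring

lemma map_one_two (v : Fin 3 → ℂ) (h : MvPolynomial.eval v fOne = 0) :
    MvPolynomial.eval (scal AA v) fTwo = 0 := by
  rw [eval_fOne] at h
  rw [eval_fTwo]
  simp only [scal, Matrix.cons_val]
  set y := v 1
  set b := v 2 ^ 2 * v 0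
  by_cases hb : b = 0
  · have : y = 0 := by simpa [hb] using h
    simp [this, hb]
  have hb' := norm_ne_zero_iff.2 hb
  rcases mul_eq_zero.1 h with h | h
  · have hk := kk_pos_mul (y := y) hb one_pos (by push_cast; linear_combination h)
    simp [AA, hk, h]
  · have hk := kk_neg_mul (y := y) hb one_pos (by push_cast; linear_combination h)
    have h3 : ‖y‖ ^ 3 = 1 ^ 3 * ‖b‖ := by
      rw [← norm_pow, eq_neg_of_add_eq_zero_left h]; simp
    have hy : y ≠ 0 := by rintro h0; rw [h0] at h3; simp at h3; exact hb' h3.symm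
    have hm := mm_cube hy one_pos h3
    have : ((AA y b : ℝ) : ℂ) ^ 3 = 2 := by
      simp only [AA, hk, hm]
      have := cc_cube
      simp
      exact_mod_cast this
    apply mul_eq_zero_of_right
    rw [mul_pow, this]
    linear_combination 2 * h

lemma map_two_one (v : Fin 3 → ℂ) (h : MvPolynomial.eval v fTwo = 0) :
    MvPolynomial.eval (scal BB v) fOne = 0 := by
  rw [eval_fTwo] at h
  rw [eval_fOne]
  simp only [scal, Matrix.cons_val]
  set y := v 1
  set b := v 2 ^ 2 * v 0
  by_cases hb : b = 0
  · have : y = 0 := by simpa [hb] using h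
    simp [this, hb]
  have hb' := norm_ne_zero_iff.2 hb
  rcases mul_eq_zero.1 h with h | h
  · have hk := kk_pos_mul (y := y) hb one_pos (by push_cast; linear_combination h)
    simp [BB, hk, h]
  · have hk := kk_neg_mul (y := y) hb two_pos (by push_cast; linear_combination h)
    have h3 : ‖y‖ ^ 3 = (1 + cc) ^ 3 * ‖b‖ := by
      rw [← norm_pow, eq_neg_of_add_eq_zero_left h, cc_cube]; simp
    have hc := cc_pos
    have hy : y ≠ 0 := by
      rintro h0; rw [h0, cc_cube] at h3; simp at h3; exact hb h3
    have hm := mm_cube hy (by positivity) h3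
    have : ((BB y b : ℝ) : ℂ) ^ 3 = 1 / 2 := by
      have h5 : BB y b = 1 / (1 + cc) := by
        simp only [BB, hk, hm, mul_one, mul_one_div, min_self]
        field_simp
        ring
      rw [h5, ← Complex.ofReal_pow, div_pow, cc_cube]
      simp
    apply mul_eq_zero_of_right
    rw [mul_pow, this]
    linear_combination (1 / 2) * h

lemma same_comb : SameCombinatorialType (projCurve fOne) (projCurve fTwo) := by
  refine ⟨phiP.toPartialHomeomorph, by simp, by simp, ?_⟩
  ext P
  constructor
  · rintro ⟨Q, hQ, rfl⟩
    induction Q using Projectivization.ind with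
    | h v hv =>
      rw [mem_projCurve hs_fOne] at hQ
      exact (mem_projCurve hs_fTwo _ (scal_ne AA_pos hv)).2 (map_one_two v hQ)
  · intro hP
    refine ⟨phiP.symm P, ?_, by simp⟩
    induction P using Projectivization.ind with
    | h v hv =>
      rw [mem_projCurve hs_fTwo] at hP
      exact (mem_projCurve hs_fOne _ (scal_ne BB_pos hv)).2 (map_two_one v hP)

/-- chains in `S` with steps at most `η` -/
def Chn (S : Set C3) (η : ℝ) (p q : C3) : Prop :=
  Relation.ReflTransGen (fun a b => a ∈ S ∧ b ∈ S ∧ ‖a - b‖ ≤ η) p q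

lemma Chn.symm {S : Set C3} {η : ℝ} {p q : C3} (h : Chn S η p q) : Chn S η q p := by
  induction h with
  | refl => exact Relation.ReflTransGen.refl
  | tail _ h ih =>
    exact Relation.ReflTransGen.head ⟨h.2.1, h.1, by rw [norm_sub_rev]; exact h.2.2⟩ ih

lemma Chn.mono {S S' : Set C3} {η η' : ℝ} {p q : C3} (h : Chn S η p q) (hS : S ⊆ S')
    (hη : η ≤ η') : Chn S' η' p q := by
  induction h with
  | refl => exact Relation.ReflTransGen.refl
  | tail _ h ih =>
    exact Relation.ReflTransGen.tail ih ⟨hS h.1, hS h.2.1, h.2.2.trans hη⟩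

lemma Chn.map {A B : Set C3} {f : C3 → C3} {K R η : ℝ} {p q : C3} (hK : 0 ≤ K)
    (h : Chn (A ∩ Metric.closedBall p R) η p q) (hp : p ∈ A)
    (hf : ∀ a ∈ A, f a ∈ B) (hL : ∀ a ∈ A, ∀ b ∈ A, ‖f a - f b‖ ≤ K * ‖a - b‖) :
    Chn (B ∩ Metric.closedBall (f p) (K * R)) (K * η) (f p) (f q) := by
  have key : ∀ a ∈ A ∩ Metric.closedBall p R, f a ∈ B ∩ Metric.closedBall (f p) (K * R) := by
    rintro a ⟨ha, ha'⟩
    refine ⟨hf a ha, ?_⟩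
    rw [mem_closedBall_iff_norm] at *
    exact (hL a ha p hp).trans (by gcongr)
  induction h with
  | refl => exact Relation.ReflTransGen.refl
  | tail _ h ih =>
    refine Relation.ReflTransGen.tail ih
      ⟨key _ h.1, key _ h.2.1, (hL _ h.1.1 _ h.2.1.1).trans ?_⟩
    exact mul_le_mul_of_nonneg_left h.2.2 hK

lemma Chn.of_seq {S : Set C3} {η : ℝ} (f : ℕ → C3) (n : ℕ) (h1 : ∀ i ≤ n, f i ∈ S)
    (h2 : ∀ i < n, ‖f i - f (i + 1)‖ ≤ η) : Chn S η (f 0) (f n) := by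
  induction n with
  | zero => exact Relation.ReflTransGen.refl
  | succ n ih =>
    refine Relation.ReflTransGen.tail (ih (fun i hi => h1 i (by omega)) (fun i hi => h2 i (by omega))) ?_
    exact ⟨h1 n (by omega), h1 (n + 1) le_rfl, h2 n (by omega)⟩

/-- If a property is preserved along steps it holds at the end. -/
lemma Chn.induct {S : Set C3} {η : ℝ} {p q : C3} (h : Chn S η p q) (P : C3 → Prop) (hp : P p)
    (hs : ∀ a ∈ S, ∀ b ∈ S, ‖a - b‖ ≤ η → P a → P b) : P q := by
  induction h with
  | refl => exact hp
  | tail _ h ih => exact hs _ h.1 _ h.2.1 h.2.2 ih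

lemma Chn.mem {S : Set C3} {η : ℝ} {p q : C3} (h : Chn S η p q) (hp : p ∈ S) : q ∈ S :=
  h.induct (· ∈ S) hp (fun _ _ _ hb _ _ => hb)

lemma exists_root {G : ℂ → ℂ} (hG : Differentiable ℂ G) {r m : ℝ} (hr : 0 < r)
    (h0 : ‖G 0‖ < m) (hm : ∀ z, ‖z‖ = r → m ≤ ‖G z‖) : ∃ z, ‖z‖ ≤ r ∧ G z = 0 := by
  by_contra! hcon
  have hm0 : 0 < m := (norm_nonneg _).trans_lt h0
  have hne : ∀ z ∈ closure (Metric.ball (0 : ℂ) r), G z ≠ 0 := by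
    intro z hz
    rw [closure_ball _ hr.ne'] at hz
    exact hcon z (by simpa using hz)
  have hd : DiffContOnCl ℂ (fun z => (G z)⁻¹) (Metric.ball 0 r) :=
    (hG.diffContOnCl).inv hne
  have := Complex.norm_le_of_forall_mem_frontier_norm_le (C := m⁻¹) Metric.isBounded_ball hd
    (fun z hz => by
      rw [frontier_ball _ hr.ne'] at hz
      have hz' : ‖z‖ = r := by simpa using hz
      rw [norm_inv]
      exact inv_anti₀ hm0 (hm z hz')) (z := 0) (subset_closure (by simpa using hr))
  rw [norm_inv] at this
  have hG0 : 0 < ‖G 0‖ := norm_pos_iff.2 (hcon 0 (by simpa using hr.le))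
  have := (inv_le_inv₀ hG0 hm0).1 this
  linarith

/-- quantitative implicit function lemma, in chain form -/
lemma graph_lemma {F : C3 → ℂ} {p w e : C3} {a : ℂ} {L d : ℝ} (hL : 1 ≤ L) (hd : 0 < d)
    (hw : ‖w‖ ≤ d) (he : ‖e‖ ≤ 1) (ha : a ≠ 0) (hp : F p = 0)
    (hF : ∀ u, Differentiable ℂ (fun z : ℂ => F (u + z • e)))
    (H : ∀ s ∈ Set.Icc (0 : ℝ) 1, ∀ s' ∈ Set.Icc (0 : ℝ) 1, ∀ z z' : ℂ, ‖z‖ ≤ 4 * L * d →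
      ‖z'‖ ≤ 4 * L * d →
      ‖F (p + (s' : ℂ) • w + z' • e) - F (p + (s : ℂ) • w + z • e) - a * (z' - z)‖ ≤
        ‖a‖ / 4 * ‖z' - z‖ + L * ‖a‖ * |s' - s| * d) :
    ∃ z : ℂ, ‖z‖ ≤ 4 * L * d ∧ F (p + w + z • e) = 0 ∧
      (∀ z', ‖z'‖ ≤ 4 * L * d → F (p + w + z' • e) = 0 → z' = z) ∧
      ∀ ε > 0, Chn ({u | F u = 0} ∩ Metric.closedBall p (5 * L * d)) ε p (p + w + z • e) := by
  have ha' : 0 < ‖a‖ := norm_pos_iff.2 ha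
  have hLd : 0 < L * d := by positivity
  have ex : ∀ s ∈ Set.Icc (0 : ℝ) 1, ∃ z : ℂ, ‖z‖ ≤ 4 * L * d ∧
      F (p + (s : ℂ) • w + z • e) = 0 := by
    intro s hs
    have H0 : ∀ z : ℂ, ‖z‖ ≤ 4 * L * d → ‖F (p + (s : ℂ) • w + z • e) - a * z‖ ≤
        ‖a‖ / 4 * ‖z‖ + L * ‖a‖ * d := by
      intro z hz
      have := H 0 (by simp) s hs 0 z (by simp; positivity) hz
      simp [hp] at this
      refine this.trans ?_
      have : |s| ≤ 1 := by rw [abs_le]; constructor <;> linarith [hs.1, hs.2]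
      have : L * ‖a‖ * |s| * d ≤ L * ‖a‖ * 1 * d := by gcongr
      linarith
    refine exists_root (G := fun z => F (p + (s : ℂ) • w + z • e)) (hF _) (r := 4 * L * d)
      (m := 2 * (L * d) * ‖a‖) (by positivity) ?_ ?_
    · have := H0 0 (by simp; positivity)
      simp at this
      simp
      nlinarith [mul_pos hLd ha']
    · intro z hz
      have h1 := H0 z hz.le
      have h2 : ‖a * z‖ ≤ ‖F (p + (s : ℂ) • w + z • e)‖ +
          ‖F (p + (s : ℂ) • w + z • e) - a * z‖ := by
        have := norm_sub_le (F (p + (s : ℂ) • w + z • e)) (F (p + (s : ℂ) • w + z • e) - a * z)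
        rwa [sub_sub_cancel] at this
      rw [norm_mul, hz] at h2
      rw [hz] at h1
      nlinarith [mul_pos hLd ha']
  have lip : ∀ s ∈ Set.Icc (0 : ℝ) 1, ∀ s' ∈ Set.Icc (0 : ℝ) 1, ∀ z z' : ℂ, ‖z‖ ≤ 4 * L * d →
      ‖z'‖ ≤ 4 * L * d → F (p + (s' : ℂ) • w + z' • e) = 0 → F (p + (s : ℂ) • w + z • e) = 0 →
      ‖z' - z‖ ≤ 2 * L * d * |s' - s| := by
    intro s hs s' hs' z z' hz hz' h1 h2
    have := H s hs s' hs' z z' hz hz'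
    rw [h1, h2] at this
    simp only [sub_self, zero_sub, norm_neg, norm_mul] at this
    have h3 : ‖a‖ * (3 / 4 * ‖z' - z‖) ≤ ‖a‖ * (L * |s' - s| * d) := by linarith
    have h4 := le_of_mul_le_mul_left h3 ha'
    have : 0 ≤ L * d * |s' - s| := by positivity
    nlinarith
  choose! ζ hζ1 hζ2 using ex
  have h1mem : (1 : ℝ) ∈ Set.Icc (0 : ℝ) 1 := by simp
  have h0mem : (0 : ℝ) ∈ Set.Icc (0 : ℝ) 1 := by simp
  refine ⟨ζ 1, hζ1 1 h1mem, by simpa using hζ2 1 h1mem, ?_, ?_⟩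
  · intro z' hz' h
    have := lip 1 h1mem 1 h1mem (ζ 1) z' (hζ1 1 h1mem) hz' (by simpa using h) (hζ2 1 h1mem)
    simp [sub_eq_zero] at this
    exact this
  · intro ε hε
    have hz0 : ζ 0 = 0 := by
      have := lip 0 h0mem 0 h0mem 0 (ζ 0) (by simp; positivity) (hζ1 0 h0mem) (hζ2 0 h0mem)
        (by simpa using hp)
      simpa using this
    obtain ⟨n, hn⟩ := exists_nat_gt (3 * L * d / ε)
    have hn0 : (0 : ℝ) < n := lt_of_le_of_lt (by positivity) hn
    set f : ℕ → C3 := fun i => p + (((i / n : ℝ) : ℂ)) • w + ζ (i / n : ℝ) • e with hf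
    have hm : ∀ i ≤ n, (i / n : ℝ) ∈ Set.Icc (0 : ℝ) 1 := by
      intro i hi
      refine ⟨by positivity, div_le_one_of_le₀ (by exact_mod_cast hi) hn0.le⟩
    have := Chn.of_seq (S := {u | F u = 0} ∩ Metric.closedBall p (5 * L * d)) (η := ε) f n ?_ ?_
    · have e0 : f 0 = p := by simp [hf, hz0]
      have e1 : f n = p + w + ζ 1 • e := by
        have : (n : ℂ) ≠ 0 := by exact_mod_cast hn0.ne'
        simp [hf, div_self hn0.ne', div_self this]
      rwa [e0, e1] at this
    · intro i hi
      have hi' := hm i hi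
      refine ⟨hζ2 _ hi', ?_⟩
      rw [mem_closedBall_iff_norm]
      have : f i - p = (((i / n : ℝ) : ℂ)) • w + ζ (i / n : ℝ) • e := by simp only [hf]; abel
      rw [this]
      refine (norm_add_le _ _).trans ?_
      rw [norm_smul, norm_smul, Complex.norm_real, Real.norm_eq_abs, abs_of_nonneg hi'.1]
      have h1 : (i / n : ℝ) * ‖w‖ ≤ 1 * d := mul_le_mul hi'.2 hw (norm_nonneg _) (by norm_num)
      have h2 : ‖ζ (i / n : ℝ)‖ * ‖e‖ ≤ 4 * L * d * 1 :=
        mul_le_mul (hζ1 _ hi') he (norm_nonneg _) (by positivity)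
      nlinarith
    · intro i hi
      have hi' := hm i hi.le
      have hi2 := hm (i + 1) hi
      have h3 := lip _ hi' _ hi2 _ _ (hζ1 _ hi') (hζ1 _ hi2) (hζ2 _ hi2) (hζ2 _ hi')
      have hs : |((i + 1 : ℕ) / n : ℝ) - i / n| = 1 / n := by
        push_cast
        rw [show ((i : ℝ) + 1) / n - i / n = 1 / n by ring]
        exact abs_of_nonneg (by positivity)
      rw [hs] at h3
      have : f i - f (i + 1) = -((((((i + 1 : ℕ) / n : ℝ) - i / n : ℝ)) : ℂ) • w +
          (ζ ((i + 1 : ℕ) / n : ℝ) - ζ (i / n : ℝ)) • e) := by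
        simp only [hf, Complex.ofReal_sub, sub_smul]; abel
      rw [this, norm_neg]
      refine (norm_add_le _ _).trans ?_
      rw [norm_smul, norm_smul, Complex.norm_real, Real.norm_eq_abs, hs]
      have h4 : 1 / (n : ℝ) * ‖w‖ ≤ 1 / n * d := by gcongr
      have h5 : ‖ζ ((i + 1 : ℕ) / n : ℝ) - ζ (i / n : ℝ)‖ * ‖e‖ ≤ 2 * L * d * (1 / n) * 1 :=
        mul_le_mul h3 he (norm_nonneg _) (by positivity)
      have h6 : 3 * L * d * (1 / n) ≤ ε := by
        rw [div_lt_iff₀ hε] at hn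
        rw [mul_one_div, div_le_iff₀ hn0]; linarith
      have h7 : 1 / (n : ℝ) * d ≤ L * d * (1 / n) := by
        have : 0 < 1 / (n : ℝ) * d := by positivity
        nlinarith
      push_cast at *
      linarith

def FO (x y z : ℂ) : ℂ := y ^ 6 - z ^ 4 * x ^ 2 + (x + y + z) ^ 7
def FT (x y z : ℂ) : ℂ := y ^ 6 + y ^ 3 * z ^ 2 * x - 2 * z ^ 4 * x ^ 2 + (x + y + z) ^ 7

lemma mem_XOne {p : C3} : p ∈ XOne ↔ FO (p 0) (p 1) (p 2) = 0 := by
  simp only [XOne, Set.mem_ofPred_eq, map_add, eval_fOne, gSeven, FO, map_pow,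
    MvPolynomial.eval_X]
  ring_nf

lemma mem_XTwo {p : C3} : p ∈ XTwo ↔ FT (p 0) (p 1) (p 2) = 0 := by
  simp only [XTwo, Set.mem_ofPred_eq, map_add, eval_fTwo, gSeven, FT, map_pow,
    MvPolynomial.eval_X]
  ring_nf

lemma c3_coord_le (u : C3) (i : Fin 3) : ‖u i‖ ≤ ‖u‖ := PiLp.norm_apply_le u i

lemma c3_norm_le (u : C3) : ‖u‖ ≤ ‖u 0‖ + ‖u 1‖ + ‖u 2‖ := by
  rw [EuclideanSpace.norm_eq, Fin.sum_univ_three]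
  apply Real.sqrt_le_iff.2
  refine ⟨by positivity, ?_⟩
  have := norm_nonneg (u 0)
  have := norm_nonneg (u 1)
  have := norm_nonneg (u 2)
  nlinarith [mul_nonneg (norm_nonneg (u 0)) (norm_nonneg (u 1)),
    mul_nonneg (norm_nonneg (u 0)) (norm_nonneg (u 2)),
    mul_nonneg (norm_nonneg (u 1)) (norm_nonneg (u 2))]

lemma pow_diff_le {a b : ℂ} {Z : ℝ} (ha : ‖a‖ ≤ Z) (hb : ‖b‖ ≤ Z) (n : ℕ) :
    ‖a ^ (n + 1) - b ^ (n + 1)‖ ≤ (n + 1) * Z ^ n * ‖a - b‖ := by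
  have hZ : 0 ≤ Z := (norm_nonneg _).trans ha
  induction n with
  | zero => simp
  | succ n ih =>
    have e : a ^ (n + 1 + 1) - b ^ (n + 1 + 1) =
      a * (a ^ (n + 1) - b ^ (n + 1)) + b ^ (n + 1) * (a - b) := by ring
    rw [e]
    refine (norm_add_le _ _).trans ?_
    rw [norm_mul, norm_mul, norm_pow]
    have h1 : ‖a‖ * ‖a ^ (n + 1) - b ^ (n + 1)‖ ≤ Z * ((n + 1) * Z ^ n * ‖a - b‖) := by gcongr
    have h2 : ‖b‖ ^ (n + 1) * ‖a - b‖ ≤ Z ^ (n + 1) * ‖a - b‖ := by gcongr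
    refine (add_le_add h1 h2).trans (le_of_eq ?_)
    push_cast; ring

lemma pow_diff2_le {a b c : ℂ} {Z r : ℝ} (ha : ‖a‖ ≤ Z) (hb : ‖b‖ ≤ Z) (hc : ‖c‖ ≤ Z)
    (hac : ‖a - c‖ ≤ r) (hbc : ‖b - c‖ ≤ r) (n : ℕ) :
    ‖a ^ (n + 2) - b ^ (n + 2) - (n + 2) * c ^ (n + 1) * (a - b)‖ ≤
      (n + 2) * (n + 1) * Z ^ n * r * ‖a - b‖ := by
  have hZ : 0 ≤ Z := (norm_nonneg _).trans ha
  have hr : 0 ≤ r := (norm_nonneg _).trans hac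
  induction n with
  | zero =>
    have e : a ^ (0 + 2) - b ^ (0 + 2) - ((0 : ℕ) + 2) * c ^ (0 + 1) * (a - b) =
      ((a - c) + (b - c)) * (a - b) := by push_cast; ring
    rw [e, norm_mul]
    have : ‖(a - c) + (b - c)‖ ≤ 2 * r := (norm_add_le _ _).trans (by linarith)
    refine (mul_le_mul_of_nonneg_right this (norm_nonneg _)).trans (le_of_eq ?_)
    push_cast; ring
  | succ n ih =>
    have e : a ^ (n + 1 + 2) - b ^ (n + 1 + 2) - (((n + 1 : ℕ) : ℂ) + 2) * c ^ (n + 1 + 1) * (a - b)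
      = a * (a ^ (n + 2) - b ^ (n + 2) - (n + 2) * c ^ (n + 1) * (a - b)) +
        (n + 2) * c ^ (n + 1) * (a - c) * (a - b) + (b ^ (n + 1 + 1) - c ^ (n + 1 + 1)) * (a - b) := by
      push_cast; ring
    rw [e]
    refine (norm_add₃_le).trans ?_
    simp only [norm_mul, norm_pow]
    have h0 : ‖((n : ℂ) + 2)‖ = n + 2 := by
      have : ((n : ℂ) + 2) = ((n + 2 : ℕ) : ℂ) := by push_cast; ring
      rw [this, Complex.norm_natCast]; push_cast; ring
    have h1 := mul_le_mul ha ih (norm_nonneg _) hZ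
    have h2 : ‖((n : ℂ) + 2)‖ * ‖c‖ ^ (n + 1) * ‖a - c‖ * ‖a - b‖ ≤
      (n + 2) * Z ^ (n + 1) * r * ‖a - b‖ := by rw [h0]; gcongr
    have h3 : ‖b ^ (n + 1 + 1) - c ^ (n + 1 + 1)‖ * ‖a - b‖ ≤
        (((n + 1 : ℕ) + 1) * Z ^ (n + 1) * r) * ‖a - b‖ := by
      gcongr
      exact (pow_diff_le hb hc (n + 1)).trans (by gcongr)
    refine (add_le_add (add_le_add h1 h2) h3).trans (le_of_eq ?_)
    push_cast; ring

/-- monomial comparison -/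
lemma tau_le {τ k : ℝ} (hτ : 0 < τ) (hτ1 : τ ≤ 1) (hk0 : 0 ≤ k) (hk : k * τ ≤ 1) {m n : ℕ}
    (h : n + 1 ≤ m) : k * τ ^ m ≤ τ ^ n := by
  have h1 : τ ^ m ≤ τ ^ (n + 1) := pow_le_pow_of_le_one hτ.le hτ1 h
  calc k * τ ^ m ≤ k * τ ^ (n + 1) := by gcongr
    _ = (k * τ) * τ ^ n := by ring
    _ ≤ 1 * τ ^ n := by gcongr
    _ = τ ^ n := one_mul _

lemma core2 {τ : ℝ} (hτ : 0 < τ) (hs : 1000000 * τ ≤ 1) {x y y' b b' : ℂ}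
    (hx : ‖x‖ ≤ 2 * τ ^ 30) (hy : ‖y - Complex.I * τ ^ 35‖ ≤ 40 * τ ^ 38)
    (hy' : ‖y' - Complex.I * τ ^ 35‖ ≤ 40 * τ ^ 38) (hb : ‖b‖ ≤ τ ^ 39) (hb' : ‖b'‖ ≤ τ ^ 39) :
    ‖FT x y' b' - FT x y b - 6 * (Complex.I * τ ^ 35) ^ 5 * (y' - y)‖ ≤
      τ ^ 175 * ‖y' - y‖ + ‖x * y ^ 3 * (b' ^ 2 - b ^ 2)‖ + τ ^ 175 * ‖b' - b‖ := by
  have hτ1 : τ ≤ 1 := by linarith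
  set y0 : ℂ := Complex.I * τ ^ 35 with hy0
  have ny0 : ‖y0‖ = τ ^ 35 := by simp [hy0, abs_of_pos hτ]
  have T : ∀ {k : ℝ} {m n : ℕ}, 0 ≤ k → k ≤ 1000000 → n + 1 ≤ m → k * τ ^ m ≤ τ ^ n :=
    fun h0 h1 h2 => tau_le hτ hτ1 h0 (by nlinarith) h2
  have s1 : 40 * τ ^ 38 ≤ τ ^ 35 := T (by norm_num) (by norm_num) (by norm_num)
  have s2 : 2 * τ ^ 35 ≤ τ ^ 30 / 2 := by
    have : 4 * τ ^ 35 ≤ τ ^ 30 := T (by norm_num) (by norm_num) (by norm_num)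
    linarith
  have s3 : τ ^ 39 ≤ τ ^ 30 / 2 := by
    have : 4 * τ ^ 39 ≤ τ ^ 30 := T (by norm_num) (by norm_num) (by norm_num)
    linarith [pow_pos hτ 39]
  have by_ : ∀ y : ℂ, ‖y - y0‖ ≤ 40 * τ ^ 38 → ‖y‖ ≤ 2 * τ ^ 35 := by
    intro y hy
    have := norm_add_le (y - y0) y0
    rw [sub_add_cancel] at this
    linarith
  have ny := by_ y hy
  have ny' := by_ y' hy'
  have e : FT x y' b' - FT x y b - 6 * y0 ^ 5 * (y' - y) =
      (y' ^ (4 + 2) - y ^ (4 + 2) - ((4 : ℕ) + 2) * y0 ^ (4 + 1) * (y' - y))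
      + x * b' ^ 2 * (y' ^ (2 + 1) - y ^ (2 + 1)) + x * y ^ 3 * (b' ^ 2 - b ^ 2)
      + (-2 * x ^ 2) * (b' ^ (3 + 1) - b ^ (3 + 1))
      + ((x + y' + b') ^ (6 + 1) - (x + y + b) ^ (6 + 1)) := by
    simp only [FT]; push_cast; ring
  rw [e]
  have h1 := pow_diff2_le ny' ny (by rw [ny0]; linarith [pow_pos hτ 35]) hy' hy 4
  have h2 : ‖x * b' ^ 2 * (y' ^ (2 + 1) - y ^ (2 + 1))‖ ≤
      2 * τ ^ 30 * (τ ^ 39) ^ 2 * (((2 : ℕ) + 1) * (2 * τ ^ 35) ^ 2 * ‖y' - y‖) := by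
    rw [norm_mul, norm_mul, norm_pow]
    gcongr
    exact pow_diff_le ny' ny 2
  have h3 : ‖(-2 * x ^ 2) * (b' ^ (3 + 1) - b ^ (3 + 1))‖ ≤
      (2 * (2 * τ ^ 30) ^ 2) * (((3 : ℕ) + 1) * (τ ^ 39) ^ 3 * ‖b' - b‖) := by
    rw [norm_mul, norm_mul, norm_pow]
    gcongr
    · simp
    · exact pow_diff_le hb' hb 3
  have h4 : ‖(x + y' + b') ^ (6 + 1) - (x + y + b) ^ (6 + 1)‖ ≤
      ((6 : ℕ) + 1) * (3 * τ ^ 30) ^ 6 * (‖y' - y‖ + ‖b' - b‖) := by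
    have g1 : ‖x + y' + b'‖ ≤ 3 * τ ^ 30 := norm_add₃_le.trans (by linarith)
    have g2 : ‖x + y + b‖ ≤ 3 * τ ^ 30 := norm_add₃_le.trans (by linarith)
    refine (pow_diff_le g1 g2 6).trans ?_
    gcongr
    have : x + y' + b' - (x + y + b) = (y' - y) + (b' - b) := by ring
    rw [this]; exact norm_add_le _ _
  have u1 : 30 * 16 * 40 * τ ^ 178 + 24 * τ ^ 178 + 5103 * τ ^ 180 ≤ τ ^ 175 := by
    have a1 : 100000 * τ ^ 178 ≤ τ ^ 175 := T (by norm_num) (by norm_num) (by norm_num)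
    have a2 : 100000 * τ ^ 180 ≤ τ ^ 175 := T (by norm_num) (by norm_num) (by norm_num)
    linarith [pow_pos hτ 178, pow_pos hτ 180]
  have u2 : 32 * τ ^ 177 + 5103 * τ ^ 180 ≤ τ ^ 175 := by
    have a1 : 100000 * τ ^ 177 ≤ τ ^ 175 := T (by norm_num) (by norm_num) (by norm_num)
    have a2 : 100000 * τ ^ 180 ≤ τ ^ 175 := T (by norm_num) (by norm_num) (by norm_num)
    linarith [pow_pos hτ 177, pow_pos hτ 180]
  have v1 := mul_le_mul_of_nonneg_right u1 (norm_nonneg (y' - y))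
  have v2 := mul_le_mul_of_nonneg_right u2 (norm_nonneg (b' - b))
  refine (norm_add_le _ _).trans ?_
  refine (add_le_add (norm_add_le _ _) le_rfl).trans ?_
  refine (add_le_add (add_le_add norm_add₃_le le_rfl) le_rfl).trans ?_
  refine (add_le_add (add_le_add (add_le_add (add_le_add h1 h2) le_rfl) h3) h4).trans ?_
  push_cast
  ring_nf at v1 v2 ⊢
  linarith

lemma sep_sq {z : ℂ} {ρ : ℝ} (hρ : 0 < ρ) (h : ‖z ^ 2 - (ρ : ℂ) ^ 2‖ ≤ ρ ^ 2 / 16) :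
    ‖z - ρ‖ ≤ ρ / 4 ∨ ‖z + ρ‖ ≤ ρ / 4 := by
  by_contra! hc
  have : ‖z ^ 2 - (ρ : ℂ) ^ 2‖ = ‖z - ρ‖ * ‖z + ρ‖ := by rw [← norm_mul]; congr 1; ring
  rw [this] at h
  nlinarith [mul_lt_mul'' hc.1 hc.2 (by positivity) (by positivity)]

lemma sep2 {τ M : ℝ} (hM : 1 ≤ M) (hτ : 0 < τ) (hs : 100000000 * M ^ 4 * τ ≤ 1)
    {x y b : ℂ} (hx : ‖x‖ ≤ 2 * τ ^ 30) (hx' : τ ^ 30 / 2 ≤ ‖x‖)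
    (hy : ‖y - Complex.I * τ ^ 35‖ ≤ 40 * τ ^ 38) (hb : b ^ 2 = (τ ^ 39 : ℂ) ^ 2)
    (h0 : FT x y b = 0) {X Y Z : ℂ} (hX : ‖X - x‖ ≤ M * τ ^ 39) (hY : ‖Y - y‖ ≤ M * τ ^ 39)
    (hZ : ‖Z - b‖ ≤ M * τ ^ 39) (h1 : FT X Y Z = 0) :
    ‖Z ^ 2 - (τ ^ 39 : ℂ) ^ 2‖ ≤ (τ ^ 39) ^ 2 / 16 := by
  have hM4 : 1 ≤ M ^ 4 := one_le_pow₀ hM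
  have hτ1 : τ ≤ 1 := by nlinarith
  have T : ∀ {k : ℝ} {m n : ℕ}, 0 ≤ k → k ≤ 100000000 * M ^ 4 → n + 1 ≤ m → k * τ ^ m ≤ τ ^ n :=
    fun h0 h1 h2 => tau_le hτ hτ1 h0 (by nlinarith) h2
  have c1 : (1000 : ℝ) ≤ 100000000 * M ^ 4 := by nlinarith
  have m1 : M ≤ M ^ 4 := le_self_pow₀ hM (by norm_num)
  have s1 : 400 * τ ^ 38 ≤ τ ^ 35 := T (by norm_num) (by linarith) (by norm_num)
  have s2 : 100 * τ ^ 35 ≤ τ ^ 30 := T (by norm_num) (by linarith) (by norm_num)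
  have s3 : M * τ ^ 39 ≤ τ ^ 35 / 2 := by
    have : (2 * M) * τ ^ 39 ≤ τ ^ 35 := T (by linarith) (by linarith) (by norm_num)
    linarith
  have hp35 := pow_pos hτ 35
  have hp30 := pow_pos hτ 30
  have hp39 := pow_pos hτ 39
  have nb : ‖b‖ = τ ^ 39 := by
    have := congrArg norm hb
    rw [norm_pow, norm_pow, norm_pow, Complex.norm_real, Real.norm_eq_abs, abs_of_pos hτ] at this
    exact (pow_left_inj₀ (norm_nonneg _) (by positivity) two_ne_zero).1 this
  have ny0 : ‖Complex.I * (τ : ℂ) ^ 35‖ = τ ^ 35 := by simp [abs_of_pos hτ]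
  have ny : ‖y‖ ≤ 2 * τ ^ 35 := by
    have := norm_add_le (y - Complex.I * τ ^ 35) (Complex.I * τ ^ 35)
    rw [sub_add_cancel] at this
    linarith
  have ny' : τ ^ 35 / 2 ≤ ‖y‖ := by
    have := norm_sub_le y (y - Complex.I * τ ^ 35)
    rw [sub_sub_cancel] at this
    linarith
  have nY : ‖Y‖ ≤ 3 * τ ^ 35 := by
    have := norm_add_le (Y - y) y
    rw [sub_add_cancel] at this
    linarith
  have nX : ‖X‖ ≤ 3 * τ ^ 30 := by
    have := norm_add_le (X - x) x
    rw [sub_add_cancel] at this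
    linarith
  have nZ : ‖Z‖ ≤ 2 * M * τ ^ 39 := by
    have := norm_add_le (Z - b) b
    rw [sub_add_cancel] at this
    nlinarith
  have e : y ^ 3 * x * (Z ^ 2 - (τ ^ 39 : ℂ) ^ 2) =
      -(Z ^ 2 * Y ^ 3 * (X - x)) - Z ^ 2 * x * (Y ^ (2 + 1) - y ^ (2 + 1))
      - (Y ^ (5 + 1) - y ^ (5 + 1)) + 2 * Z ^ 4 * X ^ 2 - 2 * b ^ 4 * x ^ 2
      - ((X + Y + Z) ^ (6 + 1) - (x + y + b) ^ (6 + 1)) := by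
    rw [← hb]
    have := h1.trans h0.symm
    simp only [FT] at this
    linear_combination this
  have k1 : ‖Z ^ 2 * Y ^ 3 * (X - x)‖ ≤ (2 * M * τ ^ 39) ^ 2 * (3 * τ ^ 35) ^ 3 * (M * τ ^ 39) := by
    rw [norm_mul, norm_mul, norm_pow, norm_pow]; gcongr
  have k2 : ‖Z ^ 2 * x * (Y ^ (2 + 1) - y ^ (2 + 1))‖ ≤ (2 * M * τ ^ 39) ^ 2 * (2 * τ ^ 30) *
      (((2 : ℕ) + 1) * (3 * τ ^ 35) ^ 2 * (M * τ ^ 39)) := by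
    rw [norm_mul, norm_mul, norm_pow]; gcongr
    exact (pow_diff_le nY (by linarith) 2).trans (by gcongr)
  have k3 : ‖Y ^ (5 + 1) - y ^ (5 + 1)‖ ≤ (((5 : ℕ) + 1) * (3 * τ ^ 35) ^ 5 * (M * τ ^ 39)) :=
    (pow_diff_le nY (by linarith) 5).trans (by gcongr)
  have k4 : ‖2 * Z ^ 4 * X ^ 2‖ ≤ 2 * (2 * M * τ ^ 39) ^ 4 * (3 * τ ^ 30) ^ 2 := by
    rw [norm_mul, norm_mul, norm_pow, norm_pow, Complex.norm_ofNat]; gcongr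
  have k5 : ‖2 * b ^ 4 * x ^ 2‖ ≤ 2 * (τ ^ 39) ^ 4 * (2 * τ ^ 30) ^ 2 := by
    rw [norm_mul, norm_mul, norm_pow, norm_pow, Complex.norm_ofNat]; gcongr; exact nb.le
  have k6 : ‖(X + Y + Z) ^ (6 + 1) - (x + y + b) ^ (6 + 1)‖ ≤
      ((6 : ℕ) + 1) * (4 * τ ^ 30) ^ 6 * (3 * (M * τ ^ 39)) := by
    have g1 : ‖X + Y + Z‖ ≤ 4 * τ ^ 30 := norm_add₃_le.trans (by linarith)
    have g2 : ‖x + y + b‖ ≤ 4 * τ ^ 30 := norm_add₃_le.trans (by rw [nb]; nlinarith)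
    refine (pow_diff_le g1 g2 6).trans ?_
    gcongr
    have : X + Y + Z - (x + y + b) = (X - x) + (Y - y) + (Z - b) := by ring
    rw [this]; exact norm_add₃_le.trans (by linarith)
  have k7 : ‖y ^ 3 * x * (Z ^ 2 - (τ ^ 39 : ℂ) ^ 2)‖ ≤ 
      (2 * M * τ ^ 39) ^ 2 * (3 * τ ^ 35) ^ 3 * (M * τ ^ 39) + (2 * M * τ ^ 39) ^ 2 * (2 * τ ^ 30) *
      (((2 : ℕ) + 1) * (3 * τ ^ 35) ^ 2 * (M * τ ^ 39)) + 
      (((5 : ℕ) + 1) * (3 * τ ^ 35) ^ 5 * (M * τ ^ 39)) + 2 * (2 * M * τ ^ 39) ^ 4 * (3 * τ ^ 30) ^ 2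
      + 2 * (τ ^ 39) ^ 4 * (2 * τ ^ 30) ^ 2 + ((6 : ℕ) + 1) * (4 * τ ^ 30) ^ 6 * (3 * (M * τ ^ 39)) := by
    rw [e]
    refine (norm_sub_le _ _).trans (add_le_add ?_ k6)
    refine (norm_sub_le _ _).trans (add_le_add ?_ k5)
    refine (norm_add_le _ _).trans (add_le_add ?_ k4)
    refine (norm_sub_le _ _).trans (add_le_add ?_ k3)
    refine (norm_sub_le _ _).trans (add_le_add ?_ k2)
    rw [norm_neg]; exact k1
  rw [norm_mul, norm_mul, norm_pow] at k7
  have k8 : (τ ^ 35 / 2) ^ 3 * (τ ^ 30 / 2) * ‖Z ^ 2 - (τ ^ 39 : ℂ) ^ 2‖ ≤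
    ‖y‖ ^ 3 * ‖x‖ * ‖Z ^ 2 - (τ ^ 39 : ℂ) ^ 2‖ := by gcongr
  have m3 : M ^ 3 ≤ M ^ 4 := pow_le_pow_right₀ hM (by norm_num)
  have w1 : (100000000 * M ^ 4) * τ ^ 214 ≤ τ ^ 213 := T (by positivity) le_rfl (by norm_num)
  have w : ∀ m, 214 ≤ m → τ ^ m ≤ τ ^ 214 := fun m hm => pow_le_pow_of_le_one hτ.le hτ1 hm
  have w2 : ∀ j m : ℕ, j ≤ 4 → 214 ≤ m → M ^ j * τ ^ m ≤ M ^ 4 * τ ^ 214 := by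
    intro j m hj hm
    exact mul_le_mul (pow_le_pow_right₀ hM hj) (w m hm) (by positivity) (by positivity)
  have a1 := w2 3 222 (by norm_num) (by norm_num)
  have a2 := w2 3 217 (by norm_num) (by norm_num)
  have a3 := w2 1 214 (by norm_num) (by norm_num)
  have a4 := w2 4 216 (by norm_num) (by norm_num)
  have a5 := w2 0 216 (by norm_num) (by norm_num)
  have a6 := w2 1 219 (by norm_num) (by norm_num)
  have fin : τ ^ 135 * (‖Z ^ 2 - (τ ^ 39 : ℂ) ^ 2‖) ≤ τ ^ 135 * ((τ ^ 39) ^ 2 / 16) := by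
    have := k8.trans k7
    have a7 : 0 ≤ τ ^ 214 * M ^ 4 := by positivity
    push_cast at this
    ring_nf at this a1 a2 a3 a4 a5 a6 w1 ⊢
    linarith
  exact le_of_mul_le_mul_left fin (by positivity)

lemma half2 {τ : ℝ} (hτ : 0 < τ) (hs : 1000000 * τ ≤ 1) {x b : ℂ}
    (hx : ‖x‖ ≤ 2 * τ ^ 30) (h0 : FT x (Complex.I * τ ^ 35) 0 = 0) (hb : ‖b‖ = τ ^ 39) :
    ∃ y : ℂ, ‖y - Complex.I * τ ^ 35‖ ≤ 40 * τ ^ 38 ∧ FT x y b = 0 ∧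
      ∀ ε > 0, Chn (XTwo ∩ Metric.closedBall (!₂[x, Complex.I * τ ^ 35, 0] : C3) (50 * τ ^ 38)) ε
        !₂[x, Complex.I * τ ^ 35, 0] !₂[x, y, b] := by
  have hτ1 : τ ≤ 1 := by linarith
  set y0 : ℂ := Complex.I * τ ^ 35 with hy0
  have ny0 : ‖y0‖ = τ ^ 35 := by simp [hy0, abs_of_pos hτ]
  have hLd : 10 / τ * τ ^ 39 = 10 * τ ^ 38 := by field_simp
  have na : ‖6 * y0 ^ 5‖ = 6 * τ ^ 175 := by rw [norm_mul, norm_pow, ny0]; simp; ring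
  have nw : ‖(!₂[0, 0, b] : C3)‖ ≤ τ ^ 39 := by
    refine (c3_norm_le _).trans ?_
    simp [hb]
  have ne : ‖(!₂[0, 1, 0] : C3)‖ ≤ 1 := by
    refine (c3_norm_le _).trans ?_
    simp
  have pt : ∀ s z : ℂ, (!₂[x, y0, 0] : C3) + s • (!₂[0, 0, b] : C3) + z • (!₂[0, 1, 0] : C3) =
      !₂[x, y0 + z, s * b] := by
    intro s z
    ext i; fin_cases i <;> simp
  obtain ⟨z, hz, hFz, -, hch⟩ := graph_lemma (F := fun u : C3 => FT (u 0) (u 1) (u 2))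
    (p := !₂[x, y0, 0]) (w := !₂[0, 0, b]) (e := !₂[0, 1, 0]) (a := 6 * y0 ^ 5) (L := 10 / τ)
    (d := τ ^ 39) (by rw [le_div_iff₀ hτ]; linarith) (by positivity) nw ne
    (by rw [← norm_pos_iff, na]; positivity) (by simpa using h0)
    (by intro u; simp [FT]; fun_prop)
    (by
      intro s hs1 s' hs1' z z' hz hz'
      have hz2 : ‖z‖ ≤ 40 * τ ^ 38 := by
        rw [mul_assoc, hLd] at hz; linarith
      have hz2' : ‖z'‖ ≤ 40 * τ ^ 38 := by
        rw [mul_assoc, hLd] at hz'; linarith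
      rw [pt, pt, na]
      have bs : ∀ s ∈ Set.Icc (0 : ℝ) 1, ‖(s : ℂ) * b‖ ≤ τ ^ 39 := by
        intro s hs
        rw [norm_mul, hb, Complex.norm_real, Real.norm_eq_abs, abs_of_nonneg hs.1]
        nlinarith [hs.2, pow_pos hτ 39]
      have := core2 hτ hs hx (y := y0 + z) (y' := y0 + z') (b := s * b) (b' := s' * b)
        (by rw [← hy0, add_sub_cancel_left]; exact hz2) (by rw [← hy0, add_sub_cancel_left]; exact hz2') (bs s hs1) (bs s' hs1')
      simp only [add_sub_add_left_eq_sub] at this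
      have nb : ‖(s' : ℂ) * b - s * b‖ = |s' - s| * τ ^ 39 := by
        rw [← sub_mul, norm_mul, hb, ← Complex.ofReal_sub, Complex.norm_real, Real.norm_eq_abs]
      rw [nb] at this
      have s1 : 40 * τ ^ 38 ≤ τ ^ 35 := tau_le hτ hτ1 (by norm_num) (by linarith) (by norm_num)
      have nb2 : ‖x * (y0 + z) ^ 3 * ((s' * b) ^ 2 - (s * b) ^ 2)‖ ≤
          2 * τ ^ 30 * (2 * τ ^ 35) ^ 3 * (2 * τ ^ 39 * (|s' - s| * τ ^ 39)) := by
        rw [norm_mul, norm_mul, norm_pow]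
        gcongr
        · exact (norm_add_le _ _).trans (by rw [ny0]; linarith)
        · have := pow_diff_le (bs s' hs1') (bs s hs1) 1
          rw [nb] at this
          refine this.trans (le_of_eq ?_)
          push_cast; ring
      have hr : 10 / τ * (6 * τ ^ 175) * |s' - s| * τ ^ 39 = 60 * τ ^ 174 * (|s' - s| * τ ^ 39) := by
        field_simp; ring
      rw [hr]
      have s2 : τ ^ 175 ≤ τ ^ 174 := pow_le_pow_of_le_one hτ.le hτ1 (by norm_num)
      have s3 : 0 ≤ |s' - s| * τ ^ 39 := by positivity
      have s4 := mul_le_mul_of_nonneg_right s2 s3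
      have s5 : 0 ≤ τ ^ 174 * (|s' - s| * τ ^ 39) := mul_nonneg (pow_pos hτ 174).le s3
      have s6 : 0 ≤ τ ^ 175 * ‖z' - z‖ := mul_nonneg (pow_pos hτ 175).le (norm_nonneg _)
      have hfin : ‖FT x (y0 + z') (s' * b) - FT x (y0 + z) (s * b) - 6 * y0 ^ 5 * (z' - z)‖ ≤
          6 * τ ^ 175 / 4 * ‖z' - z‖ + 60 * τ ^ 174 * (|s' - s| * τ ^ 39) := by
        refine this.trans ?_
        ring_nf at nb2 s4 s5 s6 ⊢
        linarith
      simpa using hfin)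
  have hz2 : ‖z‖ ≤ 40 * τ ^ 38 := by
    rw [mul_assoc, hLd] at hz; linarith
  have pt1 := pt 1 z
  rw [one_smul, one_mul] at pt1
  rw [pt1] at hFz hch
  refine ⟨y0 + z, by simpa using hz2, by simpa using hFz, fun ε hε => ?_⟩
  refine (hch ε hε).mono ?_ le_rfl
  rw [mul_assoc, hLd, show 5 * (10 * τ ^ 38) = 50 * τ ^ 38 by ring]
  exact Set.inter_subset_inter_left _ (fun u hu => mem_XTwo.2 hu)

lemma M2 {τ M : ℝ} (hM : 1 ≤ M) (hτ : 0 < τ) (hs : 100000000 * M ^ 4 * τ ≤ 1) :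
    ∃ p ∈ XTwo, ∃ q ∈ XTwo, τ ^ 30 / 2 ≤ ‖p‖ ∧ ‖p‖ ≤ 4 * τ ^ 30 ∧ ‖p - q‖ ≤ 4 * τ ^ 39 ∧
      (∀ η > 0, Chn (XTwo ∩ Metric.closedBall p (100 * τ ^ 38)) η p q) ∧
      ¬ Chn (XTwo ∩ Metric.closedBall p (M * τ ^ 39)) (τ ^ 39 / 8) p q := by
  have hM4 : 1 ≤ M ^ 4 := one_le_pow₀ hM
  have hs6 : 1000000 * τ ≤ 1 := by nlinarith
  have hτ1 : τ ≤ 1 := by linarith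
  set y0 : ℂ := Complex.I * τ ^ 35 with hy0
  have ny0 : ‖y0‖ = τ ^ 35 := by simp [hy0, abs_of_pos hτ]
  set x : ℂ := τ ^ 30 - y0 with hxd
  have nt : ‖(τ : ℂ) ^ 30‖ = τ ^ 30 := by simp [abs_of_pos hτ]
  have s1 : 4 * τ ^ 35 ≤ τ ^ 30 := tau_le hτ hτ1 (by norm_num) (by linarith) (by norm_num)
  have s2 : 80 * τ ^ 38 ≤ τ ^ 30 := tau_le hτ hτ1 (by norm_num) (by linarith) (by norm_num)
  have s3 : 40 * τ ^ 39 ≤ τ ^ 30 := tau_le hτ hτ1 (by norm_num) (by linarith) (by norm_num)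
  have q30 := pow_pos hτ 30
  have q35 := pow_pos hτ 35
  have q39 := pow_pos hτ 39
  have hx : ‖x‖ ≤ 2 * τ ^ 30 := (norm_sub_le _ _).trans (by rw [nt, ny0]; linarith)
  have hx' : τ ^ 30 / 2 ≤ ‖x‖ := by
    have := norm_sub_norm_le ((τ : ℂ) ^ 30) y0
    rw [nt, ny0] at this
    linarith
  have h0 : FT x y0 0 = 0 := by
    have : (Complex.I * (τ : ℂ) ^ 35) ^ 6 = - (τ : ℂ) ^ 210 := by
      rw [mul_pow, ← pow_mul, show (6 : ℕ) = 2 * 3 from rfl, pow_mul, Complex.I_sq]; norm_num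
    simp only [FT, hxd]
    rw [show ((τ : ℂ) ^ 30 - y0 + y0 + 0) = τ ^ 30 by ring, hy0, this]
    ring
  have nb : ‖(τ : ℂ) ^ 39‖ = τ ^ 39 := by simp [abs_of_pos hτ]
  obtain ⟨y1, hy1, hF1, hc1⟩ := half2 hτ hs6 hx h0 nb
  obtain ⟨y2, hy2, hF2, hc2⟩ := half2 hτ hs6 hx h0 (b := -(τ : ℂ) ^ 39) (by rw [norm_neg, nb])
  rw [← hy0] at hy1 hy2 hc1 hc2
  have hy12 : ‖y1 - y2‖ ≤ τ ^ 39 := by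
    have := core2 hτ hs6 hx hy2 hy1 (b := -(τ : ℂ) ^ 39) (b' := (τ : ℂ) ^ 39)
      (by rw [norm_neg, nb]) nb.le
    rw [hF1, hF2] at this
    rw [← hy0] at this
    have e2 : ‖(τ : ℂ) ^ 39 - -(τ : ℂ) ^ 39‖ = 2 * τ ^ 39 := by
      rw [sub_neg_eq_add, ← two_mul, norm_mul, nb]; simp
    rw [e2, even_two.neg_pow] at this
    simp only [sub_self, zero_sub, norm_neg, norm_mul, norm_pow, ny0, mul_zero, norm_zero,
      Complex.norm_ofNat] at this
    have : τ ^ 175 * ‖y1 - y2‖ ≤ τ ^ 175 * τ ^ 39 := by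
      have : 0 ≤ τ ^ 175 * τ ^ 39 := by positivity
      have e : 6 * (τ ^ 35) ^ 5 * ‖y1 - y2‖ = 6 * (τ ^ 175 * ‖y1 - y2‖) := by ring
      linarith
    exact le_of_mul_le_mul_left this (by positivity)
  set p : C3 := !₂[x, y1, (τ : ℂ) ^ 39] with hp
  set q : C3 := !₂[x, y2, -(τ : ℂ) ^ 39] with hq
  have p0 : p 0 = x := by simp [hp]
  have p1 : p 1 = y1 := by simp [hp]
  have p2 : p 2 = (τ : ℂ) ^ 39 := by simp [hp]
  have q0 : q 0 = x := by simp [hq]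
  have q1 : q 1 = y2 := by simp [hq]
  have q2 : q 2 = -(τ : ℂ) ^ 39 := by simp [hq]
  have ny1 : ‖y1‖ ≤ τ ^ 30 / 2 + τ ^ 30 / 2 := by
    have := norm_add_le (y1 - y0) y0
    rw [sub_add_cancel] at this
    linarith [pow_pos hτ 38]
  refine ⟨p, ?_, q, ?_, ?_, ?_, ?_, ?_, ?_⟩
  · rw [mem_XTwo, p0, p1, p2]; exact hF1
  · rw [mem_XTwo, q0, q1, q2]; exact hF2
  · have := c3_coord_le p 0
    rw [p0] at this; linarith
  · refine (c3_norm_le p).trans ?_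
    rw [p0, p1, p2, nb]; linarith
  · refine (c3_norm_le _).trans ?_
    simp only [PiLp.sub_apply, p0, p1, p2, q0, q1, q2, sub_self, norm_zero]
    have : ‖(τ : ℂ) ^ 39 - -(τ : ℂ) ^ 39‖ ≤ 2 * τ ^ 39 :=
      (norm_sub_le _ _).trans (by rw [norm_neg, nb]; linarith)
    linarith
  · intro η hη
    have hpm : p ∈ Metric.closedBall (!₂[x, y0, 0] : C3) (50 * τ ^ 38) := by
      rw [mem_closedBall_iff_norm]
      refine (c3_norm_le _).trans ?_
      simp [hp, abs_of_pos hτ]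
      have : τ ^ 39 ≤ τ ^ 38 := pow_le_pow_of_le_one hτ.le hτ1 (by norm_num)
      have := pow_pos hτ 38
      linarith
    refine Chn.mono (Relation.ReflTransGen.trans (hc1 η hη).symm (hc2 η hη)) ?_ le_rfl
    refine Set.inter_subset_inter_right _ (fun u hu => ?_)
    rw [Metric.mem_closedBall] at *
    have := dist_triangle_right u p (!₂[x, y0, 0] : C3)
    linarith
  · intro hch
    have key : ‖q 2 - (τ ^ 39 : ℝ)‖ ≤ τ ^ 39 / 4 := by
      refine hch.induct (fun u => ‖u 2 - (τ ^ 39 : ℝ)‖ ≤ τ ^ 39 / 4) ?_ ?_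
      · simp [p2]; positivity
      · intro a ha b hb hab h
        have hbF := mem_XTwo.1 hb.1
        have hbp := hb.2
        rw [mem_closedBall_iff_norm] at hbp
        have c0 := (c3_coord_le (b - p) 0).trans hbp
        have c1 := (c3_coord_le (b - p) 1).trans hbp
        have c2 := (c3_coord_le (b - p) 2).trans hbp
        simp only [PiLp.sub_apply, p0, p1, p2] at c0 c1 c2
        have := sep2 hM hτ hs hx hx' hy1 rfl hF1 c0 c1 c2 hbF
        rcases sep_sq (ρ := τ ^ 39) (z := b 2) q39 (by push_cast; exact this) with h' | h'
        · exact h'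
        · exfalso
          have c3 := (c3_coord_le (a - b) 2).trans hab
          simp only [PiLp.sub_apply] at c3
          have e : (2 * (τ ^ 39 : ℝ) : ℂ) = (b 2 + (τ ^ 39 : ℝ)) + (a 2 - b 2) - (a 2 - (τ ^ 39 : ℝ)) := by
            ring
          have e' : ‖(2 * (τ ^ 39 : ℝ) : ℂ)‖ = 2 * τ ^ 39 := by
            rw [norm_mul, Complex.norm_real, Real.norm_eq_abs, abs_of_pos q39]; simp
          have : ‖(2 * (τ ^ 39 : ℝ) : ℂ)‖ ≤ τ ^ 39 / 4 + τ ^ 39 / 8 + τ ^ 39 / 4 := by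
            rw [e]
            refine (norm_sub_le _ _).trans (add_le_add ((norm_add_le _ _).trans (add_le_add h' c3)) h)
          linarith
    rw [q2] at key
    have : ‖-(τ : ℂ) ^ 39 - (τ ^ 39 : ℝ)‖ = 2 * τ ^ 39 := by
      push_cast
      rw [← neg_add', norm_neg, ← two_mul, norm_mul, nb]; simp
    linarith

lemma lin1_real {Y Z r T W : ℝ} (hY : 0 ≤ Y) (hZ : 0 ≤ Z) (hr : 0 ≤ r) (hT0 : 0 ≤ T) (hrT : r ≤ T)
    (hW : W = Z + r) (hsm : 15309 * T ^ 4 ≤ r ^ 3) :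
    r * (30 * (Y + r) ^ 4 + 30 * (W ^ 2 * T ^ 2)) + 15309 * T ^ 6 ≤
      301 * r * (Y ^ 4 + Z ^ 2 * T ^ 2 + r ^ 2 * T ^ 2) := by
  have b1 : (Y + r) ^ 4 ≤ 8 * (Y ^ 4 + r ^ 4) := by
    have h2 : (Y + r) ^ 2 ≤ 2 * (Y ^ 2 + r ^ 2) := by nlinarith [sq_nonneg (Y - r)]
    calc (Y + r) ^ 4 = ((Y + r) ^ 2) ^ 2 := by ring
      _ ≤ (2 * (Y ^ 2 + r ^ 2)) ^ 2 := by gcongr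
      _ ≤ _ := by nlinarith [sq_nonneg (Y ^ 2 - r ^ 2)]
  have b2 : W ^ 2 ≤ 2 * (Z ^ 2 + r ^ 2) := by rw [hW]; nlinarith [sq_nonneg (Z - r)]
  have b3 : r ^ 4 ≤ r ^ 2 * T ^ 2 := by
    calc r ^ 4 = r ^ 2 * r ^ 2 := by ring
      _ ≤ _ := by gcongr
  have b4 : 15309 * T ^ 6 ≤ r * (r ^ 2 * T ^ 2) := by
    calc 15309 * T ^ 6 = (15309 * T ^ 4) * T ^ 2 := by ring
      _ ≤ r ^ 3 * T ^ 2 := by gcongr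
      _ = _ := by ring
  have b5 := mul_le_mul_of_nonneg_right b2 (sq_nonneg T)
  have b6 : 30 * (Y + r) ^ 4 + 30 * (W ^ 2 * T ^ 2) ≤ 300 * (Y ^ 4 + Z ^ 2 * T ^ 2 + r ^ 2 * T ^ 2) := by
    have : 0 ≤ Y ^ 4 := by positivity
    have : 0 ≤ Z ^ 2 * T ^ 2 := by positivity
    linarith
  have b7 := mul_le_mul_of_nonneg_left b6 hr
  have h1 : 0 ≤ r * Y ^ 4 := by positivity
  have h2 : 0 ≤ r * (Z ^ 2 * T ^ 2) := by positivity
  linarith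

lemma lin1 {p u v : C3} {T r : ℝ} (hT : ∀ i, ‖p i‖ + r ≤ T)
    (hu : ‖u - p‖ ≤ r) (hv : ‖v - p‖ ≤ r) (hsm : 15309 * T ^ 4 ≤ r ^ 3) :
    ‖FO (u 0) (u 1) (u 2) - FO (v 0) (v 1) (v 2) -
      (-2 * p 2 ^ 4 * p 0 * (u 0 - v 0) + 6 * p 1 ^ 5 * (u 1 - v 1)
        + -4 * p 2 ^ 3 * p 0 ^ 2 * (u 2 - v 2))‖ ≤
      301 * r * (‖p 1‖ ^ 4 + ‖p 2‖ ^ 2 * T ^ 2 + r ^ 2 * T ^ 2) * ‖u - v‖ := by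
  have hr : 0 ≤ r := (norm_nonneg _).trans hu
  have cu : ∀ i, ‖u i - p i‖ ≤ r := fun i => (c3_coord_le (u - p) i).trans hu
  have cv : ∀ i, ‖v i - p i‖ ≤ r := fun i => (c3_coord_le (v - p) i).trans hv
  have nu : ∀ i, ‖u i‖ ≤ ‖p i‖ + r := fun i => by
    have := norm_add_le (u i - p i) (p i)
    rw [sub_add_cancel] at this
    linarith [cu i]
  have nv : ∀ i, ‖v i‖ ≤ ‖p i‖ + r := fun i => by
    have := norm_add_le (v i - p i) (p i)
    rw [sub_add_cancel] at this
    linarith [cv i]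
  have np : ∀ i, ‖p i‖ ≤ ‖p i‖ + r := fun i => by linarith
  have hT0 : 0 ≤ T := (norm_nonneg (p 0)).trans (by linarith [hT 0])
  have hrT : r ≤ T := by linarith [hT 0, norm_nonneg (p 0)]
  set δ := ‖u - v‖ with hδ
  have d : ∀ i, ‖u i - v i‖ ≤ δ := fun i => c3_coord_le (u - v) i
  have hδ0 : 0 ≤ δ := norm_nonneg _
  set W := ‖p 2‖ + r with hW
  have hW0 : 0 ≤ W := by positivity
  have hWT : W ≤ T := hT 2
  have e : FO (u 0) (u 1) (u 2) - FO (v 0) (v 1) (v 2) -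
      (-2 * p 2 ^ 4 * p 0 * (u 0 - v 0) + 6 * p 1 ^ 5 * (u 1 - v 1)
        + -4 * p 2 ^ 3 * p 0 ^ 2 * (u 2 - v 2)) =
      (u 1 ^ (4 + 2) - v 1 ^ (4 + 2) - ((4 : ℕ) + 2) * p 1 ^ (4 + 1) * (u 1 - v 1))
      - u 2 ^ 4 * (u 0 ^ (0 + 2) - v 0 ^ (0 + 2) - ((0 : ℕ) + 2) * p 0 ^ (0 + 1) * (u 0 - v 0))
      - 2 * p 0 * (u 2 ^ (3 + 1) - p 2 ^ (3 + 1)) * (u 0 - v 0)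
      - v 0 ^ 2 * (u 2 ^ (2 + 2) - v 2 ^ (2 + 2) - ((2 : ℕ) + 2) * p 2 ^ (2 + 1) * (u 2 - v 2))
      - 4 * p 2 ^ 3 * (v 0 ^ (1 + 1) - p 0 ^ (1 + 1)) * (u 2 - v 2)
      + ((u 0 + u 1 + u 2) ^ (6 + 1) - (v 0 + v 1 + v 2) ^ (6 + 1)) := by
    simp only [FO]; push_cast; ring
  have k1 : ‖u 1 ^ (4 + 2) - v 1 ^ (4 + 2) - ((4 : ℕ) + 2) * p 1 ^ (4 + 1) * (u 1 - v 1)‖ ≤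
      ((4 : ℕ) + 2) * ((4 : ℕ) + 1) * (‖p 1‖ + r) ^ 4 * r * δ :=
    (pow_diff2_le (nu 1) (nv 1) (np 1) (cu 1) (cv 1) 4).trans (by gcongr; exact d 1)
  have k2 : ‖u 2 ^ 4 * (u 0 ^ (0 + 2) - v 0 ^ (0 + 2) - ((0 : ℕ) + 2) * p 0 ^ (0 + 1) * (u 0 - v 0))‖
      ≤ W ^ 2 * T ^ 2 * (2 * r * δ) := by
    rw [norm_mul, norm_pow]
    have a1 : ‖u 2‖ ^ 4 ≤ W ^ 2 * T ^ 2 := by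
      calc ‖u 2‖ ^ 4 ≤ W ^ 4 := by gcongr; exact nu 2
        _ = W ^ 2 * W ^ 2 := by ring
        _ ≤ _ := by gcongr
    gcongr
    refine (pow_diff2_le (nu 0) (nv 0) (np 0) (cu 0) (cv 0) 0).trans ?_
    have := d 0
    push_cast; simp; gcongr
  have k3 : ‖2 * p 0 * (u 2 ^ (3 + 1) - p 2 ^ (3 + 1)) * (u 0 - v 0)‖ ≤
      2 * T * (((3 : ℕ) + 1) * (W ^ 2 * T) * r) * δ := by
    rw [norm_mul, norm_mul, norm_mul, Complex.norm_ofNat]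
    have := d 0
    have := hT 0
    have a : ‖u 2 ^ (3 + 1) - p 2 ^ (3 + 1)‖ ≤ ((3 : ℕ) + 1) * (W ^ 2 * T) * r := by
      refine (pow_diff_le (nu 2) (np 2) 3).trans ?_
      rw [show (‖p 2‖ + r) ^ 3 = W ^ 2 * W by rw [hW]; ring]
      have := cu 2
      gcongr
    gcongr
    linarith
  have k4 : ‖v 0 ^ 2 * (u 2 ^ (2 + 2) - v 2 ^ (2 + 2) - ((2 : ℕ) + 2) * p 2 ^ (2 + 1) * (u 2 - v 2))‖
      ≤ T ^ 2 * (((2 : ℕ) + 2) * ((2 : ℕ) + 1) * W ^ 2 * r * δ) := by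
    rw [norm_mul, norm_pow]
    have := d 2
    have := hT 0
    have := nv 0
    have a := (pow_diff2_le (nu 2) (nv 2) (np 2) (cu 2) (cv 2) 2)
    gcongr
    · linarith
    · exact a.trans (by gcongr)
  have k5 : ‖4 * p 2 ^ 3 * (v 0 ^ (1 + 1) - p 0 ^ (1 + 1)) * (u 2 - v 2)‖ ≤
      4 * (W ^ 2 * T) * (((1 : ℕ) + 1) * T ^ 1 * r) * δ := by
    rw [norm_mul, norm_mul, norm_mul, norm_pow, Complex.norm_ofNat]
    have := d 2
    have a1 : ‖p 2‖ ^ 3 ≤ W ^ 2 * T := by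
      calc ‖p 2‖ ^ 3 ≤ W ^ 3 := by gcongr; exact np 2
        _ = W ^ 2 * W := by ring
        _ ≤ _ := by gcongr
    have a := (pow_diff_le ((nv 0).trans (hT 0)) ((np 0).trans (hT 0)) 1)
    have := cv 0
    gcongr
    exact a.trans (by gcongr)
  have k6 : ‖(u 0 + u 1 + u 2) ^ (6 + 1) - (v 0 + v 1 + v 2) ^ (6 + 1)‖ ≤
      ((6 : ℕ) + 1) * (3 * T) ^ 6 * (3 * δ) := by
    have g1 : ‖u 0 + u 1 + u 2‖ ≤ 3 * T := norm_add₃_le.trans (by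
      linarith [nu 0, nu 1, nu 2, hT 0, hT 1, hT 2])
    have g2 : ‖v 0 + v 1 + v 2‖ ≤ 3 * T := norm_add₃_le.trans (by
      linarith [nv 0, nv 1, nv 2, hT 0, hT 1, hT 2])
    refine (pow_diff_le g1 g2 6).trans ?_
    gcongr
    have : u 0 + u 1 + u 2 - (v 0 + v 1 + v 2) = (u 0 - v 0) + (u 1 - v 1) + (u 2 - v 2) := by ring
    rw [this]; exact norm_add₃_le.trans (by linarith [d 0, d 1, d 2])
  rw [e]
  have tot := (norm_add_le _ _).trans (add_le_add ((norm_sub_le _ _).trans (add_le_add ((norm_sub_le _ _).trans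
    (add_le_add ((norm_sub_le _ _).trans (add_le_add ((norm_sub_le _ _).trans (add_le_add k1 k2)) k3))
    k4)) k5)) k6)
  refine tot.trans ?_
  have b8 := lin1_real (norm_nonneg (p 1)) (norm_nonneg (p 2)) hr hT0 hrT hW hsm
  have b9 := mul_le_mul_of_nonneg_right b8 hδ0
  refine le_trans (le_of_eq ?_) b9
  push_cast; ring

lemma smooth1 {p q : C3} {T d : ℝ} (hp : p ∈ XOne) (hq : q ∈ XOne) (hd : 0 < d)
    (hT : ∀ i, ‖p i‖ + 20 * d ≤ T) (hsm : 15309 * T ^ 4 ≤ (20 * d) ^ 3) (hpq : ‖q - p‖ ≤ d)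
    {S : ℝ} (hS : S = ‖p 1‖ ^ 4 + ‖p 2‖ ^ 2 * T ^ 2 + (20 * d) ^ 2 * T ^ 2)
    (hbig : 1204 * (20 * d) * S ≤ 2 * ‖p 2‖ ^ 4 * ‖p 0‖ ∨ 1204 * (20 * d) * S ≤ 6 * ‖p 1‖ ^ 5 ∨
      1204 * (20 * d) * S ≤ 4 * ‖p 2‖ ^ 3 * ‖p 0‖ ^ 2) {ε : ℝ} (hε : 0 < ε) :
    Chn (XOne ∩ Metric.closedBall p (20 * d)) ε p q := by
  set c : Fin 3 → ℂ := ![-2 * p 2 ^ 4 * p 0, 6 * p 1 ^ 5, -4 * p 2 ^ 3 * p 0 ^ 2] with hc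
  obtain ⟨i, -, hi⟩ := Finset.exists_max_image Finset.univ (fun i => ‖c i‖) ⟨0, Finset.mem_univ _⟩
  have hi : ∀ j, ‖c j‖ ≤ ‖c i‖ := fun j => hi j (Finset.mem_univ j)
  have hT0 : 0 < T := by linarith [hT 0, norm_nonneg (p 0)]
  have hS0 : 0 < S := by rw [hS]; positivity
  have hai : 1204 * (20 * d) * S ≤ ‖c i‖ := by
    rcases hbig with h | h | h
    · refine (h.trans (le_of_eq ?_)).trans (hi 0); simp [hc]
    · refine (h.trans (le_of_eq ?_)).trans (hi 1); simp [hc]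
    · refine (h.trans (le_of_eq ?_)).trans (hi 2); simp [hc]
  have ha0 : 0 < ‖c i‖ := lt_of_lt_of_le (by positivity) hai
  set lam : C3 → ℂ := fun w => c 0 * w 0 + c 1 * w 1 + c 2 * w 2 with hlam
  have lam_le : ∀ w, ‖lam w‖ ≤ 3 * ‖c i‖ * ‖w‖ := by
    intro w
    refine norm_add₃_le.trans ?_
    simp only [norm_mul]
    have h : ∀ j, ‖c j‖ * ‖w j‖ ≤ ‖c i‖ * ‖w‖ := fun j => by
      gcongr
      · exact hi j
      · exact c3_coord_le w j
    linarith [h 0, h 1, h 2]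
  set e : C3 := EuclideanSpace.single i 1 with he
  have ne : ‖e‖ ≤ 1 := by simp [he]
  have lam_e : lam e = c i := by
    fin_cases i <;> simp [hlam, he]
  have lam_lin : ∀ (s z : ℂ) (w : C3), lam (s • w + z • e) = s * lam w + z * c i := by
    intro s z w
    rw [← lam_e]
    simp only [hlam, PiLp.add_apply, PiLp.smul_apply, smul_eq_mul]
    ring
  obtain ⟨z, hz, hFz, huniq, hch⟩ := graph_lemma (F := fun u : C3 => FO (u 0) (u 1) (u 2))
    (p := p) (w := q - p) (e := e) (a := c i) (L := 4) (d := d) (by norm_num) hd hpq ne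
    (norm_pos_iff.1 ha0) (mem_XOne.1 hp)
    (by intro u; simp [FO]; fun_prop)
    (by
      intro s hs s' hs' z z' hz hz'
      have hball : ∀ s ∈ Set.Icc (0 : ℝ) 1, ∀ z : ℂ, ‖z‖ ≤ 4 * 4 * d →
          ‖p + (s : ℂ) • (q - p) + z • e - p‖ ≤ 20 * d := by
        intro s hs z hz
        rw [add_assoc, add_sub_cancel_left]
        refine (norm_add_le _ _).trans ?_
        rw [norm_smul, norm_smul, Complex.norm_real, Real.norm_eq_abs, abs_of_nonneg hs.1]
        have h1 : s * ‖q - p‖ ≤ 1 * d := mul_le_mul hs.2 hpq (norm_nonneg _) (by norm_num)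
        have h2 : ‖z‖ * ‖e‖ ≤ 4 * 4 * d * 1 :=
          mul_le_mul hz ne (norm_nonneg _) (by positivity)
        linarith
      have key := lin1 hT (hball s' hs' z' hz') (hball s hs z hz) hsm
      rw [← hS] at key
      set u := p + (s' : ℂ) • (q - p) + z' • e with hu
      set v := p + (s : ℂ) • (q - p) + z • e with hv
      have huv : u - v = ((s' : ℂ) - s) • (q - p) + (z' - z) • e := by
        rw [hu, hv, sub_smul, sub_smul]; abel
      have nuv : ‖u - v‖ ≤ |s' - s| * d + ‖z' - z‖ := by
        rw [huv]
        refine (norm_add_le _ _).trans ?_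
        rw [norm_smul, norm_smul, ← Complex.ofReal_sub, Complex.norm_real, Real.norm_eq_abs]
        have h1 : |s' - s| * ‖q - p‖ ≤ |s' - s| * d := by gcongr
        have h2 : ‖z' - z‖ * ‖e‖ ≤ ‖z' - z‖ * 1 := by gcongr
        linarith
      have hl : lam (u - v) = ((s' : ℂ) - s) * lam (q - p) + (z' - z) * c i := by
        rw [huv, lam_lin]
      have hl2 : lam (u - v) = -2 * p 2 ^ 4 * p 0 * (u 0 - v 0) + 6 * p 1 ^ 5 * (u 1 - v 1)
        + -4 * p 2 ^ 3 * p 0 ^ 2 * (u 2 - v 2) := by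
        simp [hlam, hc]
      rw [← hl2, hl] at key
      have h3 : ‖((s' : ℂ) - s) * lam (q - p)‖ ≤ |s' - s| * (3 * ‖c i‖ * d) := by
        rw [norm_mul, ← Complex.ofReal_sub, Complex.norm_real, Real.norm_eq_abs]
        gcongr
        exact (lam_le _).trans (by gcongr)
      have h4 : 301 * (20 * d) * S * ‖u - v‖ ≤ ‖c i‖ / 4 * (|s' - s| * d + ‖z' - z‖) := by
        gcongr
        linarith
      have h5 : 0 ≤ |s' - s| * (‖c i‖ * d) := by positivity
      have e6 : FO (u 0) (u 1) (u 2) - FO (v 0) (v 1) (v 2) - c i * (z' - z) =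
          (FO (u 0) (u 1) (u 2) - FO (v 0) (v 1) (v 2) -
            (((s' : ℂ) - s) * lam (q - p) + (z' - z) * c i)) + ((s' : ℂ) - s) * lam (q - p) := by
        ring
      show ‖FO (u 0) (u 1) (u 2) - FO (v 0) (v 1) (v 2) - c i * (z' - z)‖ ≤ _
      rw [e6]
      refine (norm_add_le _ _).trans ((add_le_add (key.trans h4) h3).trans ?_)
      nlinarith)
  have h0 : (0 : ℂ) = z := huniq 0 (by simp; positivity) (by simpa using mem_XOne.1 hq)
  have hh := hch ε hε
  rw [← h0] at hh
  simp only [zero_smul, add_zero, add_sub_cancel] at hh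
  refine hh.mono ?_ le_rfl
  rw [show (5 * 4 * d : ℝ) = 20 * d by ring]
  exact Set.inter_subset_inter_left _ (fun u hu => mem_XOne.2 hu)

lemma dicho {κ B r T X Y Z l S A2 A3 : ℝ} (hκ : 0 < κ) (hB : 0 < B) (hr : 0 < r) (hrT : r ≤ T)
    (hX : 0 ≤ X) (hY : 0 ≤ Y) (hZ : 0 ≤ Z) (hXT : X ≤ T) (hYT : Y ≤ T) (hZT : Z ≤ T)
    (hsum : κ * T ≤ X + Y + Z) (hl : X - Y - Z ≤ l) (hl7 : l ^ 7 ≤ Y ^ 6 + Z ^ 4 * X ^ 2)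
    (hS : S = Y ^ 4 + Z ^ 2 * T ^ 2 + r ^ 2 * T ^ 2)
    (a1 : 2 * Z ^ 4 * X < B * r * S) (a2 : 6 * Y ^ 5 < B * r * S) (a3 : 4 * Z ^ 3 * X ^ 2 < B * r * S)
    (hA2 : A2 = 4 * B / κ ^ 2 + 1) (hA3 : A3 = B * (A2 ^ 2 + 1))
    (h1 : 3 * B * r * T ^ 4 ≤ 6 * (κ * T / 16) ^ 5)
    (h2 : 2 * (B / 3 * r) ^ 6 ≤ (κ * T / 4) ^ 7)
    (h3 : 2 * (A2 ^ 4 * r ^ 4 * T ^ 2) ≤ (κ * T / 4) ^ 7)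
    (h4 : A3 ^ 6 * r ^ 18 * T ^ 12 < ((κ * T / 4) ^ 7 / 2) ^ 5) :
    κ * T / 4 ≤ Z ∧ X ≤ 3 * B / 2 * (4 / κ) ^ 4 * r := by
  have hT : 0 < T := hr.trans_le hrT
  have hκT : 0 < κ * T := by positivity
  have S3 : S ≤ 3 * T ^ 4 := by
    have b1 : Y ^ 4 ≤ T ^ 4 := by gcongr
    have b2 : Z ^ 2 * T ^ 2 ≤ T ^ 2 * T ^ 2 := by gcongr
    have b3 : r ^ 2 * T ^ 2 ≤ T ^ 2 * T ^ 2 := by gcongr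
    have : T ^ 2 * T ^ 2 = T ^ 4 := by ring
    rw [hS]; linarith
  have BS : B * r * S ≤ 3 * B * r * T ^ 4 := by
    calc B * r * S ≤ B * r * (3 * T ^ 4) := by gcongr
      _ = _ := by ring
  have Y1 : Y < κ * T / 16 := by
    by_contra! h
    have : (κ * T / 16) ^ 5 ≤ Y ^ 5 := by gcongr
    linarith
  by_cases hZc : κ * T / 4 ≤ Z
  · refine ⟨hZc, ?_⟩
    have b1 : 2 * (κ * T / 4) ^ 4 * X ≤ 2 * Z ^ 4 * X := by gcongr
    have b2 : 2 * (κ * T / 4) ^ 4 * X ≤ 3 * B * r * T ^ 4 := by linarith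
    have b3 : (2 * (κ * T / 4) ^ 4) * X ≤ (2 * (κ * T / 4) ^ 4) * (3 * B / 2 * (4 / κ) ^ 4 * r) := by
      refine b2.trans (le_of_eq ?_)
      field_simp
    exact le_of_mul_le_mul_left b3 (by positivity)
  · exfalso
    push Not at hZc
    have X1 : κ * T / 2 ≤ X := by linarith
    have l1 : κ * T / 4 ≤ l := by linarith
    have l2 : (κ * T / 4) ^ 7 ≤ Y ^ 6 + Z ^ 4 * T ^ 2 := by
      have : (κ * T / 4) ^ 7 ≤ l ^ 7 := by gcongr
      have : Z ^ 4 * X ^ 2 ≤ Z ^ 4 * T ^ 2 := by gcongr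
      linarith
    by_cases hc : Z ^ 2 * T ^ 2 + r ^ 2 * T ^ 2 ≤ Y ^ 4
    · have Y0 : 0 < Y := by
        by_contra! h
        have : Y = 0 := le_antisymm h hY
        rw [this] at hc
        have : 0 < r ^ 2 * T ^ 2 := by positivity
        have : 0 ≤ Z ^ 2 * T ^ 2 := by positivity
        norm_num at hc
        linarith
      have c1 : B * r * S ≤ B * r * (2 * Y ^ 4) := by gcongr; linarith
      have c2 : Y ^ 4 * (6 * Y) < Y ^ 4 * (2 * B * r) := by
        calc Y ^ 4 * (6 * Y) = 6 * Y ^ 5 := by ring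
          _ < B * r * (2 * Y ^ 4) := by linarith
          _ = _ := by ring
      have c3 := lt_of_mul_lt_mul_left c2 (by positivity)
      have c4 : Z ^ 2 * T ^ 2 ≤ Y ^ 4 := by
        have : 0 < r ^ 2 * T ^ 2 := by positivity
        linarith
      have c5 : T ^ 2 * (Z ^ 4 * T ^ 2) ≤ T ^ 2 * Y ^ 6 := by
        calc T ^ 2 * (Z ^ 4 * T ^ 2) = (Z ^ 2 * T ^ 2) ^ 2 := by ring
          _ ≤ (Y ^ 4) ^ 2 := by gcongr
          _ = Y ^ 2 * Y ^ 6 := by ring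
          _ ≤ _ := by gcongr
      have c6 := le_of_mul_le_mul_left c5 (by positivity)
      have c7 : Y ^ 6 < (B / 3 * r) ^ 6 := by
        apply pow_lt_pow_left₀ _ hY (by norm_num)
        linarith
      linarith
    · push Not at hc
      have c1 : B * r * S ≤ B * r * (2 * (Z ^ 2 + r ^ 2) * T ^ 2) := by
        gcongr; rw [hS]; linarith
      have A2pos : 1 ≤ A2 := by rw [hA2]; have : 0 ≤ 4 * B / κ ^ 2 := by positivity
                                linarith
      have Z1 : Z ≤ A2 * r := by
        by_cases hzr : Z ≤ r
        · nlinarith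
        push Not at hzr
        have hZ0 : 0 < Z := hr.trans hzr
        have d1 : 4 * Z ^ 3 * (κ * T / 2) ^ 2 ≤ 4 * Z ^ 3 * X ^ 2 := by gcongr
        have d2 : r ^ 2 ≤ Z ^ 2 := by gcongr
        have d3 : B * r * (2 * (Z ^ 2 + r ^ 2) * T ^ 2) ≤ B * r * (2 * (Z ^ 2 + Z ^ 2) * T ^ 2) := by
          gcongr
        have d4 : (Z ^ 2 * T ^ 2) * (Z * κ ^ 2) ≤ (Z ^ 2 * T ^ 2) * (4 * B * r) := by
          calc (Z ^ 2 * T ^ 2) * (Z * κ ^ 2) = 4 * Z ^ 3 * (κ * T / 2) ^ 2 := by ring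
            _ ≤ B * r * (2 * (Z ^ 2 + Z ^ 2) * T ^ 2) := by linarith
            _ = _ := by ring
        have d5 := le_of_mul_le_mul_left d4 (by positivity)
        have d6 : Z ≤ 4 * B * r / κ ^ 2 := by rw [le_div_iff₀ (by positivity)]; exact d5
        rw [hA2]
        have : (4 * B / κ ^ 2 + 1) * r = 4 * B * r / κ ^ 2 + r := by ring
        linarith
      have A3pos : 0 < A3 := by rw [hA3]; positivity
      have Y5 : Y ^ 5 ≤ A3 * r ^ 3 * T ^ 2 := by
        have d1 : B * r * (2 * (Z ^ 2 + r ^ 2) * T ^ 2) ≤ B * r * (2 * ((A2 * r) ^ 2 + r ^ 2) * T ^ 2) := by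
          gcongr
        have d2 : B * r * (2 * ((A2 * r) ^ 2 + r ^ 2) * T ^ 2) = 2 * (A3 * r ^ 3 * T ^ 2) := by
          rw [hA3]; ring
        have : 0 < A3 * r ^ 3 * T ^ 2 := by positivity
        have : 0 ≤ Y ^ 5 := by positivity
        linarith
      have Z4 : Z ^ 4 * T ^ 2 ≤ A2 ^ 4 * r ^ 4 * T ^ 2 := by
        calc Z ^ 4 * T ^ 2 ≤ (A2 * r) ^ 4 * T ^ 2 := by gcongr
          _ = _ := by ring
      have Y6 : (κ * T / 4) ^ 7 / 2 ≤ Y ^ 6 := by linarith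
      have e1 : ((κ * T / 4) ^ 7 / 2) ^ 5 ≤ (Y ^ 6) ^ 5 := by gcongr
      have e2 : (Y ^ 5) ^ 6 ≤ (A3 * r ^ 3 * T ^ 2) ^ 6 := by gcongr
      have e3 : (Y ^ 6) ^ 5 = (Y ^ 5) ^ 6 := by ring
      have e4 : (A3 * r ^ 3 * T ^ 2) ^ 6 = A3 ^ 6 * r ^ 18 * T ^ 12 := by ring
      linarith

lemma ev_lt (c : ℝ) {c' : ℝ} (hc' : 0 < c') {m n : ℕ} (h : n < m) :
    ∀ᶠ τ : ℝ in 𝓝[>] 0, c * τ ^ m < c' * τ ^ n := by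
  have h1 : ∀ᶠ τ : ℝ in 𝓝[>] 0, c * τ ^ (m - n) < c' := by
    have : Filter.Tendsto (fun τ : ℝ => c * τ ^ (m - n)) (𝓝[>] 0) (𝓝 (c * 0 ^ (m - n))) :=
      ((continuous_const.mul (continuous_pow _)).tendsto 0).mono_left nhdsWithin_le_nhds
    rw [zero_pow (by omega), mul_zero] at this
    exact this.eventually_lt_const hc'
  filter_upwards [h1, self_mem_nhdsWithin] with τ h1 h2
  have h2 : 0 < τ := h2
  have : τ ^ m = τ ^ (m - n) * τ ^ n := by rw [← pow_add]; congr 1; omega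
  rw [this, ← mul_assoc]
  exact mul_lt_mul_of_pos_right h1 (pow_pos h2 n)

lemma Ediff {x0 y0 z0 x y z : ℂ} {τ C D : ℝ} (hτ : 0 < τ) (hτ1 : τ ≤ 1) (hC : 1 ≤ C) (hCD : C ≤ D)
    (h0 : ‖x0‖ ≤ C * τ ^ 30) (h1 : ‖y0‖ ≤ C * τ ^ 30) (h2 : ‖z0‖ ≤ C * τ ^ 30)
    (hy0 : ‖y0‖ ≤ D * τ ^ 33)
    (hx : ‖x - x0‖ ≤ C * τ ^ 38) (hy : ‖y - y0‖ ≤ C * τ ^ 38) (hz : ‖z - z0‖ ≤ C * τ ^ 38)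
    (hsm : (6 * (2 * D) ^ 5 * C) * τ ^ 203 < 1 / 2 * τ ^ 202)
    (hsm2 : (7 * (6 * C) ^ 6 * (3 * C)) * τ ^ 218 < 1 / 2 * τ ^ 202) :
    ‖y ^ 6 + (x + y + z) ^ 7 - (y0 ^ 6 + (x0 + y0 + z0) ^ 7)‖ ≤ τ ^ 202 := by
  have q1 : τ ^ 38 ≤ τ ^ 30 := pow_le_pow_of_le_one hτ.le hτ1 (by norm_num)
  have q2 : τ ^ 38 ≤ τ ^ 33 := pow_le_pow_of_le_one hτ.le hτ1 (by norm_num)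
  have q3 : C * τ ^ 38 ≤ C * τ ^ 30 := by gcongr
  have q4 : C * τ ^ 38 ≤ D * τ ^ 33 := by gcongr; linarith
  have add : ∀ {a b : ℂ} {s t : ℝ}, ‖a - b‖ ≤ s → ‖b‖ ≤ t → ‖a‖ ≤ s + t := by
    intro a b s t h h'
    have := norm_add_le (a - b) b
    rw [sub_add_cancel] at this
    linarith
  have nx : ‖x‖ ≤ 2 * C * τ ^ 30 := (add hx h0).trans (by linarith)
  have ny : ‖y‖ ≤ 2 * C * τ ^ 30 := (add hy h1).trans (by linarith)
  have nz : ‖z‖ ≤ 2 * C * τ ^ 30 := (add hz h2).trans (by linarith)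
  have ny' : ‖y‖ ≤ 2 * D * τ ^ 33 := (add hy hy0).trans (by linarith)
  have hD : 0 < D := by linarith
  have ny0' : ‖y0‖ ≤ 2 * D * τ ^ 33 := hy0.trans (by have : 0 < D * τ ^ 33 := by positivity
                                                     linarith)
  have e : y ^ 6 + (x + y + z) ^ 7 - (y0 ^ 6 + (x0 + y0 + z0) ^ 7) =
    (y ^ (5 + 1) - y0 ^ (5 + 1)) + ((x + y + z) ^ (6 + 1) - (x0 + y0 + z0) ^ (6 + 1)) := by ring
  rw [e]
  have k1 : ‖y ^ (5 + 1) - y0 ^ (5 + 1)‖ ≤ ((5 : ℕ) + 1) * (2 * D * τ ^ 33) ^ 5 * (C * τ ^ 38) :=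
    (pow_diff_le ny' ny0' 5).trans (by gcongr)
  have k2 : ‖(x + y + z) ^ (6 + 1) - (x0 + y0 + z0) ^ (6 + 1)‖ ≤
      ((6 : ℕ) + 1) * (6 * C * τ ^ 30) ^ 6 * (3 * (C * τ ^ 38)) := by
    have g : 0 < C * τ ^ 30 := by positivity
    have g1 : ‖x + y + z‖ ≤ 6 * C * τ ^ 30 := norm_add₃_le.trans (by linarith)
    have g2 : ‖x0 + y0 + z0‖ ≤ 6 * C * τ ^ 30 := norm_add₃_le.trans (by linarith)
    refine (pow_diff_le g1 g2 6).trans ?_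
    gcongr
    have : x + y + z - (x0 + y0 + z0) = (x - x0) + (y - y0) + (z - z0) := by ring
    rw [this]; exact norm_add₃_le.trans (by linarith)
  refine (norm_add_le _ _).trans ((add_le_add k1 k2).trans ?_)
  have e1 : ((5 : ℕ) + 1) * (2 * D * τ ^ 33) ^ 5 * (C * τ ^ 38) = (6 * (2 * D) ^ 5 * C) * τ ^ 203 := by
    push_cast; ring
  have e2 : ((6 : ℕ) + 1) * (6 * C * τ ^ 30) ^ 6 * (3 * (C * τ ^ 38)) =
      (7 * (6 * C) ^ 6 * (3 * C)) * τ ^ 218 := by push_cast; ring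
  rw [e1, e2]
  linarith

lemma sqball (x : ℂ) {e : ℝ} (he : 0 < e) :
    ∃ r, 0 < r ∧ r ≤ e ∧ ∀ ζ : ℂ, ‖ζ‖ = r → e ^ 2 / 16 ≤ ‖2 * x * ζ + ζ ^ 2‖ := by
  have f : ∀ ζ : ℂ, ‖2 * x * ζ + ζ ^ 2‖ = ‖ζ‖ * ‖2 * x + ζ‖ := by
    intro ζ; rw [← norm_mul]; congr 1; ring
  have n2 : ‖2 * x‖ = 2 * ‖x‖ := by simp
  by_cases h : ‖x‖ ≤ e / 4
  · refine ⟨e, he, le_rfl, fun ζ hζ => ?_⟩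
    rw [f, hζ]
    have := norm_sub_le (2 * x + ζ) (2 * x)
    rw [add_sub_cancel_left, hζ, n2] at this
    nlinarith
  · push Not at h
    refine ⟨e / 4, by positivity, by linarith, fun ζ hζ => ?_⟩
    rw [f, hζ]
    have := norm_sub_le (2 * x + ζ) ζ
    rw [add_sub_cancel_right, hζ, n2] at this
    nlinarith

lemma root3 {x0 y0 z0 y z : ℂ} {τ C D A c ε : ℝ} (hτ : 0 < τ) (hτ1 : τ ≤ 1) (hC : 1 ≤ C)
    (hCD : C ≤ D) (hc : 0 < c) (hA : 0 < A)
    (h0 : ‖x0‖ ≤ C * τ ^ 30) (h1 : ‖y0‖ ≤ C * τ ^ 30) (h2 : ‖z0‖ ≤ C * τ ^ 30)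
    (hy0 : ‖y0‖ ≤ D * τ ^ 33) (hx0 : ‖x0‖ ≤ A * τ ^ 39) (hz0 : c * τ ^ 30 ≤ ‖z0‖)
    (hF : FO x0 y0 z0 = 0) (hε : 0 < ε) (hε1 : ε ≤ 1)
    (hy : ‖y - y0‖ ≤ C * τ ^ 39) (hz : ‖z - z0‖ ≤ C * τ ^ 39)
    (hsm : (6 * (2 * D) ^ 5 * C) * τ ^ 203 < 1 / 2 * τ ^ 202)
    (hsm2 : (7 * (6 * C) ^ 6 * (3 * C)) * τ ^ 218 < 1 / 2 * τ ^ 202)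
    (hsm3 : C * τ ^ 39 < c / 2 * τ ^ 30)
    (hsm4 : (A ^ 2 * (4 * (2 * C) ^ 3 * C)) * τ ^ 207 < 1 * τ ^ 202)
    (hsm5 : (5 : ℝ) * τ ^ 202 < ((c / 2) ^ 4 * (ε ^ 2 / 16)) * τ ^ 198) :
    ∃ x, ‖x - x0‖ ≤ ε * τ ^ 39 ∧ FO x y z = 0 := by
  have q1 : τ ^ 39 ≤ τ ^ 38 := pow_le_pow_of_le_one hτ.le hτ1 (by norm_num)
  have q2 : τ ^ 39 ≤ τ ^ 30 := pow_le_pow_of_le_one hτ.le hτ1 (by norm_num)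
  have q3 : C * τ ^ 39 ≤ C * τ ^ 38 := by gcongr
  have q5 : C * τ ^ 39 ≤ C * τ ^ 30 := by gcongr
  have ρ0 : 0 < τ ^ 39 := by positivity
  obtain ⟨r, hr0, hr1, hr⟩ := sqball x0 (e := ε * τ ^ 39) (by positivity)
  have nz : ‖z‖ ≤ 2 * C * τ ^ 30 := by
    have := norm_add_le (z - z0) z0
    rw [sub_add_cancel] at this
    linarith
  have nz0 : ‖z0‖ ≤ 2 * C * τ ^ 30 := h2.trans (by have : 0 < C * τ ^ 30 := by positivity
                                                   linarith)
  have nz' : c / 2 * τ ^ 30 ≤ ‖z‖ := by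
    have := norm_sub_le z (z - z0)
    rw [sub_sub_cancel] at this
    linarith
  have K : ∀ x, ‖x - x0‖ ≤ ε * τ ^ 39 → ‖y ^ 6 + (x + y + z) ^ 7 - (y0 ^ 6 + (x0 + y0 + z0) ^ 7)‖ ≤ τ ^ 202 := by
    intro x hx
    refine Ediff hτ hτ1 hC hCD h0 h1 h2 hy0 ?_ (hy.trans q3) (hz.trans q3) hsm hsm2
    refine hx.trans (le_trans ?_ q3)
    gcongr; linarith
  have K2 : ‖x0 ^ 2 * (z ^ (3 + 1) - z0 ^ (3 + 1))‖ ≤ τ ^ 202 := by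
    rw [norm_mul, norm_pow]
    have a := (pow_diff_le nz nz0 3)
    calc ‖x0‖ ^ 2 * ‖z ^ (3 + 1) - z0 ^ (3 + 1)‖ ≤
        (A * τ ^ 39) ^ 2 * (((3 : ℕ) + 1) * (2 * C * τ ^ 30) ^ 3 * (C * τ ^ 39)) := by
          gcongr
          exact a.trans (by gcongr)
      _ = (A ^ 2 * (4 * (2 * C) ^ 3 * C)) * τ ^ 207 := by push_cast; ring
      _ ≤ τ ^ 202 := by linarith
  have ρε : 0 < ε * τ ^ 39 := by positivity
  have p202 : 0 < τ ^ 202 := pow_pos hτ _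
  obtain ⟨ζ, hζ, hG⟩ := exists_root (G := fun ζ => FO (x0 + ζ) y z) (r := r) (m := (2.5 : ℝ) * τ ^ 202)
    (by simp only [FO]; fun_prop) hr0
    (by
      have e : FO (x0 + 0) y z = (y ^ 6 + (x0 + y + z) ^ 7 - (y0 ^ 6 + (x0 + y0 + z0) ^ 7)) -
        x0 ^ 2 * (z ^ (3 + 1) - z0 ^ (3 + 1)) := by
        have := hF
        simp only [FO] at this ⊢
        rw [add_zero]
        linear_combination this
      show ‖FO (x0 + 0) y z‖ < _
      rw [e]
      refine (norm_sub_le _ _).trans_lt ?_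
      have := K x0 (by simpa using ρε.le)
      linarith)
    (by
      intro ζ hζ
      have e : z ^ 4 * (2 * x0 * ζ + ζ ^ 2) = (y ^ 6 + (x0 + ζ + y + z) ^ 7 - (y0 ^ 6 + (x0 + y0 + z0) ^ 7))
        - x0 ^ 2 * (z ^ (3 + 1) - z0 ^ (3 + 1)) - FO (x0 + ζ) y z := by
        have := hF
        simp only [FO] at this ⊢
        linear_combination this
      have l : ((c / 2) ^ 4 * (ε ^ 2 / 16)) * τ ^ 198 ≤ ‖z ^ 4 * (2 * x0 * ζ + ζ ^ 2)‖ := by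
        rw [norm_mul, norm_pow]
        calc ((c / 2) ^ 4 * (ε ^ 2 / 16)) * τ ^ 198 = (c / 2 * τ ^ 30) ^ 4 * ((ε * τ ^ 39) ^ 2 / 16) := by ring
          _ ≤ _ := by
            have := hr ζ hζ
            gcongr
      have u : ‖z ^ 4 * (2 * x0 * ζ + ζ ^ 2)‖ ≤ τ ^ 202 + τ ^ 202 + ‖FO (x0 + ζ) y z‖ := by
        rw [e]
        refine (norm_sub_le _ _).trans (add_le_add ((norm_sub_le _ _).trans (add_le_add ?_ K2)) le_rfl)
        apply K
        rw [add_sub_cancel_left, hζ]; exact hr1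
      have := hsm5.trans_le (l.trans u)
      linarith)
  exact ⟨x0 + ζ, by rw [add_sub_cancel_left]; exact hζ.trans hr1, hG⟩

lemma xclose {p q : C3} {τ C D A c ε η θ : ℝ} (hτ : 0 < τ) (hτ1 : τ ≤ 1) (hC : 1 ≤ C)
    (hCD : C ≤ D) (hc : 0 < c) (hA : 0 < A) (hη : 0 < η)
    (hp : p ∈ XOne) (hpn : ‖p‖ ≤ C * τ ^ 30)
    (hy0 : ‖p 1‖ ≤ D * τ ^ 33) (hx0 : ‖p 0‖ ≤ A * τ ^ 39) (hz0 : c * τ ^ 30 ≤ ‖p 2‖)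
    (hpq : ‖q - p‖ ≤ C * τ ^ 39)
    (hch : Chn (XOne ∩ Metric.closedBall p (C * τ ^ 38)) (η * τ ^ 39) p q)
    (hε : 0 < ε) (hθ : θ = ε * c ^ 2 / 16) (hηθ : 12 * C ^ 2 * η ≤ θ)
    (hsm : (6 * (2 * D) ^ 5 * C) * τ ^ 203 < 1 / 2 * τ ^ 202)
    (hsm2 : (7 * (6 * C) ^ 6 * (3 * C)) * τ ^ 218 < 1 / 2 * τ ^ 202)
    (hsm3 : C * τ ^ 39 < c / 2 * τ ^ 30)
    (hsm4 : 2 * τ ^ 101 < θ * τ ^ 99)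
    (hsm5 : (4 * A * C ^ 2) * τ ^ 108 < θ * τ ^ 99) :
    ‖q 0 - p 0‖ ≤ ε * τ ^ 39 := by
  have q1 : τ ^ 38 ≤ τ ^ 30 := pow_le_pow_of_le_one hτ.le hτ1 (by norm_num)
  have q3 : C * τ ^ 38 ≤ C * τ ^ 30 := by gcongr
  have hθ0 : 0 < θ := by rw [hθ]; positivity
  have p99 : 0 < θ * τ ^ 99 := mul_pos hθ0 (pow_pos hτ _)
  have p101 : 0 < τ ^ 101 := pow_pos hτ _
  have np : ∀ i, ‖p i‖ ≤ C * τ ^ 30 := fun i => (c3_coord_le p i).trans hpn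
  set S := XOne ∩ Metric.closedBall p (C * τ ^ 38) with hS
  have hpS : p ∈ S := ⟨hp, by simp; positivity⟩
  have hqS : q ∈ S := hch.mem hpS
  have cS : ∀ u ∈ S, ∀ i, ‖u i - p i‖ ≤ C * τ ^ 38 := by
    intro u hu i
    have := hu.2
    rw [mem_closedBall_iff_norm] at this
    exact (c3_coord_le (u - p) i).trans this
  have nS : ∀ u ∈ S, ∀ i, ‖u i‖ ≤ 2 * C * τ ^ 30 := by
    intro u hu i
    have := norm_add_le (u i - p i) (p i)
    rw [sub_add_cancel] at this
    linarith [cS u hu i, np i]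
  set w : C3 → ℂ := fun u => u 0 * u 2 ^ 2 with hw
  have hw2 : ∀ u ∈ S, ‖w u - w p‖ ≤ τ ^ 101 ∨ ‖w u + w p‖ ≤ τ ^ 101 := by
    intro u hu
    have hE := Ediff hτ hτ1 hC hCD (np 0) (np 1) (np 2) hy0 (cS u hu 0) (cS u hu 1) (cS u hu 2) hsm hsm2
    have e : (w u - w p) * (w u + w p) = u 1 ^ 6 + (u 0 + u 1 + u 2) ^ 7 -
        (p 1 ^ 6 + (p 0 + p 1 + p 2) ^ 7) := by
      have h1 := mem_XOne.1 hu.1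
      have h2 := mem_XOne.1 hp
      simp only [FO, hw] at h1 h2 ⊢
      linear_combination h2 - h1
    rw [← e, norm_mul] at hE
    by_contra! h
    have := mul_lt_mul'' h.1 h.2 p101.le p101.le
    have e2 : τ ^ 101 * τ ^ 101 = τ ^ 202 := by rw [← pow_add]
    linarith
  have hstep : ∀ a ∈ S, ∀ b ∈ S, ‖a - b‖ ≤ η * τ ^ 39 → ‖w b - w a‖ ≤ θ * τ ^ 99 := by
    intro a ha b hb hab
    have e : w b - w a = -((a 0 - b 0) * a 2 ^ 2 + b 0 * (a 2 ^ (1 + 1) - b 2 ^ (1 + 1))) := by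
      simp only [hw]; ring
    have d0 := (c3_coord_le (a - b) 0).trans hab
    have d2 := (c3_coord_le (a - b) 2).trans hab
    simp only [PiLp.sub_apply] at d0 d2
    rw [e, norm_neg]
    refine (norm_add_le _ _).trans ?_
    rw [norm_mul, norm_mul, norm_pow]
    have k := pow_diff_le (nS a ha 2) (nS b hb 2) 1
    have n1 := nS a ha 2
    have n2 := nS b hb 0
    calc ‖a 0 - b 0‖ * ‖a 2‖ ^ 2 + ‖b 0‖ * ‖a 2 ^ (1 + 1) - b 2 ^ (1 + 1)‖
        ≤ (η * τ ^ 39) * (2 * C * τ ^ 30) ^ 2 +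
          (2 * C * τ ^ 30) * (((1 : ℕ) + 1) * (2 * C * τ ^ 30) ^ 1 * (η * τ ^ 39)) := by
          gcongr
          exact k.trans (by gcongr)
      _ = (12 * C ^ 2 * η) * τ ^ 99 := by push_cast; ring
      _ ≤ θ * τ ^ 99 := by gcongr
  have hwq : ‖w q - w p‖ ≤ 3 * (θ * τ ^ 99) := by
    by_cases hbig : θ * τ ^ 99 ≤ ‖w p‖
    · have : ‖w q - w p‖ ≤ τ ^ 101 := by
        refine hch.induct (fun u => ‖w u - w p‖ ≤ τ ^ 101) (by simp; positivity) ?_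
        intro a ha b hb hab h
        rcases hw2 b hb with h' | h'
        · exact h'
        · exfalso
          have e : 2 * w p = (w b + w p) - (w b - w a) - (w a - w p) := by ring
          have n : ‖2 * w p‖ = 2 * ‖w p‖ := by simp
          have : ‖2 * w p‖ ≤ τ ^ 101 + θ * τ ^ 99 + τ ^ 101 := by
            rw [e]
            exact (norm_sub_le _ _).trans (add_le_add ((norm_sub_le _ _).trans
              (add_le_add h' (hstep a ha b hb hab))) h)
          linarith
      linarith
    · push Not at hbig
      rcases hw2 q hqS with h | h
      · linarith
      · have e : w q - w p = (w q + w p) - 2 * w p := by ring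
        have n : ‖2 * w p‖ = 2 * ‖w p‖ := by simp
        rw [e]
        refine (norm_sub_le _ _).trans ?_
        rw [n]; linarith
  have dq2 := (c3_coord_le (q - p) 2).trans hpq
  simp only [PiLp.sub_apply] at dq2
  have nz' : c / 2 * τ ^ 30 ≤ ‖q 2‖ := by
    have := norm_sub_le (q 2) (q 2 - p 2)
    rw [sub_sub_cancel] at this
    linarith
  have e : (q 0 - p 0) * q 2 ^ 2 = (w q - w p) - p 0 * (q 2 ^ (1 + 1) - p 2 ^ (1 + 1)) := by
    simp only [hw]; ring
  have k := pow_diff_le (nS q hqS 2) (nS p hpS 2) 1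
  have k2 : ‖p 0 * (q 2 ^ (1 + 1) - p 2 ^ (1 + 1))‖ ≤ θ * τ ^ 99 := by
    rw [norm_mul]
    calc ‖p 0‖ * ‖q 2 ^ (1 + 1) - p 2 ^ (1 + 1)‖ ≤
        (A * τ ^ 39) * (((1 : ℕ) + 1) * (2 * C * τ ^ 30) ^ 1 * (C * τ ^ 39)) := by
          gcongr
          exact k.trans (by gcongr)
      _ = (4 * A * C ^ 2) * τ ^ 108 := by push_cast; ring
      _ ≤ _ := hsm5.le
  have k3 : ‖q 0 - p 0‖ * ‖q 2‖ ^ 2 ≤ 4 * (θ * τ ^ 99) := by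
    rw [← norm_pow, ← norm_mul, e]
    exact (norm_sub_le _ _).trans (by linarith)
  have k4 : ‖q 0 - p 0‖ * (c / 2 * τ ^ 30) ^ 2 ≤ ‖q 0 - p 0‖ * ‖q 2‖ ^ 2 := by gcongr
  have k5 : ‖q 0 - p 0‖ * (c / 2 * τ ^ 30) ^ 2 ≤ (ε * τ ^ 39) * (c / 2 * τ ^ 30) ^ 2 := by
    refine (k4.trans k3).trans (le_of_eq ?_)
    rw [hθ]; ring
  exact le_of_mul_le_mul_right k5 (by positivity)

lemma seg_chain {p q : C3} {ρ C ε : ℝ} (hρ : 0 < ρ) (hC : 1 ≤ C) (hε : 0 < ε)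
    (hp : p ∈ XOne) (hq : q ∈ XOne) (hpq : ‖q - p‖ ≤ C * ρ)
    (hx : ‖q 0 - p 0‖ ≤ ε / 4 * ρ)
    (hroot : ∀ y z : ℂ, ‖y - p 1‖ ≤ C * ρ → ‖z - p 2‖ ≤ C * ρ →
      ∃ x, ‖x - p 0‖ ≤ ε / 4 * ρ ∧ FO x y z = 0) :
    Chn (XOne ∩ Metric.closedBall p ((2 * C + ε) * ρ)) (ε * ρ) p q := by
  obtain ⟨n, hn⟩ := exists_nat_gt (4 * C / ε)
  have hn0 : (0 : ℝ) < n := lt_of_le_of_lt (by positivity) hn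
  have hnn : n ≠ 0 := by rintro rfl; simp at hn0
  have hnc : (n : ℂ) ≠ 0 := by exact_mod_cast hnn
  set Y : ℕ → ℂ := fun i => p 1 + (i / n : ℂ) * (q 1 - p 1) with hY
  set Z : ℕ → ℂ := fun i => p 2 + (i / n : ℂ) * (q 2 - p 2) with hZ
  have d1 := (c3_coord_le (q - p) 1).trans hpq
  have d2 := (c3_coord_le (q - p) 2).trans hpq
  simp only [PiLp.sub_apply] at d1 d2
  have nin : ∀ i : ℕ, i ≤ n → ‖(i / n : ℂ)‖ ≤ 1 := by
    intro i hi
    rw [norm_div, Complex.norm_natCast, Complex.norm_natCast]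
    exact div_le_one_of_le₀ (by exact_mod_cast hi) hn0.le
  have bY : ∀ i ≤ n, ‖Y i - p 1‖ ≤ C * ρ := by
    intro i hi
    simp only [hY, add_sub_cancel_left, norm_mul]
    calc _ ≤ 1 * (C * ρ) := mul_le_mul (nin i hi) d1 (norm_nonneg _) (by norm_num)
      _ = _ := one_mul _
  have bZ : ∀ i ≤ n, ‖Z i - p 2‖ ≤ C * ρ := by
    intro i hi
    simp only [hZ, add_sub_cancel_left, norm_mul]
    calc _ ≤ 1 * (C * ρ) := mul_le_mul (nin i hi) d2 (norm_nonneg _) (by norm_num)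
      _ = _ := one_mul _
  have ex : ∀ i, i ≤ n → ∃ x, ‖x - p 0‖ ≤ ε / 4 * ρ ∧ FO x (Y i) (Z i) = 0 ∧ (i = 0 → x = p 0) ∧
      (i = n → x = q 0) := by
    intro i hi
    by_cases h0 : i = 0
    · refine ⟨p 0, by simp; positivity, ?_, fun _ => rfl, fun h => absurd (h0.symm.trans h) hnn.symm⟩
      simpa [h0, hY, hZ] using mem_XOne.1 hp
    by_cases h1 : i = n
    · refine ⟨q 0, hx, ?_, fun h => absurd h h0, fun _ => rfl⟩
      simpa [h1, hY, hZ, div_self hnc] using mem_XOne.1 hq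
    · obtain ⟨x, hx1, hx2⟩ := hroot _ _ (bY i hi) (bZ i hi)
      exact ⟨x, hx1, hx2, fun h => absurd h h0, fun h => absurd h h1⟩
  choose! X hX1 hX2 hX3 hX4 using ex
  set f : ℕ → C3 := fun i => !₂[X i, Y i, Z i] with hf
  have := Chn.of_seq (S := XOne ∩ Metric.closedBall p ((2 * C + ε) * ρ)) (η := ε * ρ) f n ?_ ?_
  · have e0 : f 0 = p := by
      ext i; fin_cases i <;> simp [hf, hX3 0 (by omega) rfl, hY, hZ]
    have e1 : f n = q := by
      ext i; fin_cases i <;> simp [hf, hX4 n le_rfl rfl, hY, hZ, div_self hnc]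
    rwa [e0, e1] at this
  · intro i hi
    refine ⟨mem_XOne.2 (by simpa [hf] using hX2 i hi), ?_⟩
    rw [mem_closedBall_iff_norm]
    refine (c3_norm_le _).trans ?_
    have h1 := hX1 i hi
    have h2 := bY i hi
    have h3 := bZ i hi
    simp only [hf, PiLp.sub_apply]
    simp
    have : 0 < ε * ρ := by positivity
    linarith
  · intro i hi
    refine (c3_norm_le _).trans ?_
    have h1 := hX1 i hi.le
    have h1' := hX1 (i + 1) hi
    have nd : ‖((i : ℂ) / n - ((i + 1 : ℕ) : ℂ) / n)‖ = 1 / n := by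
      push_cast
      rw [show ((i : ℂ) / n - ((i : ℂ) + 1) / n) = - (1 / n) by ring, norm_neg, norm_div,
        Complex.norm_natCast]; simp
    have h2 : ‖Y i - Y (i + 1)‖ ≤ 1 / n * (C * ρ) := by
      have : Y i - Y (i + 1) = ((i : ℂ) / n - ((i + 1 : ℕ) : ℂ) / n) * (q 1 - p 1) := by
        simp only [hY]; ring
      rw [this, norm_mul, nd]; gcongr
    have h3 : ‖Z i - Z (i + 1)‖ ≤ 1 / n * (C * ρ) := by
      have : Z i - Z (i + 1) = ((i : ℂ) / n - ((i + 1 : ℕ) : ℂ) / n) * (q 2 - p 2) := by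
        simp only [hZ]; ring
      rw [this, norm_mul, nd]; gcongr
    have h4 : ‖X i - X (i + 1)‖ ≤ ε / 4 * ρ + ε / 4 * ρ := by
      have : X i - X (i + 1) = (X i - p 0) - (X (i + 1) - p 0) := by ring
      rw [this]; exact (norm_sub_le _ _).trans (add_le_add h1 h1')
    have h5 : 1 / n * (C * ρ) ≤ ε / 4 * ρ := by
      rw [div_lt_iff₀ hε] at hn
      rw [one_div, inv_mul_le_iff₀ hn0]
      nlinarith
    have : ‖X i - X (i + 1)‖ + ‖Y i - Y (i + 1)‖ + ‖Z i - Z (i + 1)‖ ≤ ε * ρ := by linarith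
    simpa [hf] using this

lemma M1 {C ε : ℝ} (hC : 1 ≤ C) (hε : 0 < ε) (hε1 : ε ≤ 1) :
    ∃ M η0 : ℝ, 1 ≤ M ∧ 0 < η0 ∧ ∀ᶠ τ : ℝ in 𝓝[>] 0, ∀ p ∈ XOne, ∀ q ∈ XOne,
      τ ^ 30 / C ≤ ‖p‖ → ‖p‖ ≤ C * τ ^ 30 → ‖q - p‖ ≤ C * τ ^ 39 →
      Chn (XOne ∩ Metric.closedBall p (C * τ ^ 38)) (η0 * τ ^ 39) p q →
      Chn (XOne ∩ Metric.closedBall p (M * τ ^ 39)) (ε * τ ^ 39) p q := by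
  have hC0 : 0 < C := by linarith
  obtain ⟨κ, hκe⟩ : ∃ κ : ℝ, κ = 1 / (2 * C ^ 2) := ⟨_, rfl⟩
  have hκ : 0 < κ := by rw [hκe]; positivity
  obtain ⟨c, hce⟩ : ∃ c : ℝ, c = κ * C / 2 := ⟨_, rfl⟩
  have hc : 0 < c := by rw [hce]; positivity
  obtain ⟨A, hAe⟩ : ∃ A : ℝ, A = 3 * 1204 / 2 * (4 / κ) ^ 4 * (20 * C) := ⟨_, rfl⟩
  have hA : 0 < A := by rw [hAe]; positivity
  obtain ⟨D, hDe⟩ : ∃ D : ℝ, D = C ^ 4 * A ^ 2 + (3 * C) ^ 7 + C := ⟨_, rfl⟩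
  have hCD : C ≤ D := by rw [hDe]; have : 0 < C ^ 4 * A ^ 2 + (3 * C) ^ 7 := by positivity
                         linarith
  have hD0 : 0 < D := by linarith
  obtain ⟨A2, hA2⟩ : ∃ A2 : ℝ, A2 = 4 * 1204 / κ ^ 2 + 1 := ⟨_, rfl⟩
  obtain ⟨A3, hA3⟩ : ∃ A3 : ℝ, A3 = 1204 * (A2 ^ 2 + 1) := ⟨_, rfl⟩
  obtain ⟨θ, hθ⟩ : ∃ θ : ℝ, θ = ε / 4 * c ^ 2 / 16 := ⟨_, rfl⟩
  have hθ0 : 0 < θ := by rw [hθ]; positivity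
  refine ⟨20 * C + (2 * C + ε), θ / (12 * C ^ 2), by linarith, by positivity, ?_⟩
  filter_upwards [self_mem_nhdsWithin,
    ev_lt 1 (c' := 1) one_pos (m := 1) (n := 0) (by norm_num),
    ev_lt (15309 * (2 * C) ^ 4) (c' := (20 * C) ^ 3) (by positivity) (m := 120) (n := 117) (by norm_num),
    ev_lt (20 * C) (c' := C) (by positivity) (m := 39) (n := 30) (by norm_num),
    ev_lt (3 * 1204 * (20 * C) * (2 * C) ^ 4) (c' := 6 * (κ * (2 * C) / 16) ^ 5) (by positivity)
      (m := 159) (n := 150) (by norm_num),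
    ev_lt (2 * (1204 / 3 * (20 * C)) ^ 6) (c' := (κ * (2 * C) / 4) ^ 7) (by positivity)
      (m := 234) (n := 210) (by norm_num),
    ev_lt (2 * (A2 ^ 4 * (20 * C) ^ 4 * (2 * C) ^ 2)) (c' := (κ * (2 * C) / 4) ^ 7) (by positivity)
      (m := 216) (n := 210) (by norm_num),
    ev_lt (A3 ^ 6 * (20 * C) ^ 18 * (2 * C) ^ 12) (c' := ((κ * (2 * C) / 4) ^ 7 / 2) ^ 5)
      (by positivity) (m := 1062) (n := 1050) (by norm_num),
    ev_lt (6 * (2 * D) ^ 5 * C) (c' := 1 / 2) (by norm_num) (m := 203) (n := 202) (by norm_num),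
    ev_lt (7 * (6 * C) ^ 6 * (3 * C)) (c' := 1 / 2) (by norm_num) (m := 218) (n := 202) (by norm_num),
    ev_lt C (c' := c / 2) (by positivity) (m := 39) (n := 30) (by norm_num),
    ev_lt (A ^ 2 * (4 * (2 * C) ^ 3 * C)) (c' := 1) (by norm_num) (m := 207) (n := 202) (by norm_num),
    ev_lt 5 (c' := (c / 2) ^ 4 * ((ε / 4) ^ 2 / 16)) (by positivity) (m := 202) (n := 198) (by norm_num),
    ev_lt 2 (c' := θ) (by positivity) (m := 101) (n := 99) (by norm_num),
    ev_lt (4 * A * C ^ 2) (c' := θ) (by positivity) (m := 108) (n := 99) (by norm_num)]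
    with τ hτ e1 e2 e3 e4 e5 e6 e7 s1 s2 s3 s4 s5 s6 s7
  have hτ : 0 < τ := hτ
  have hτ1 : τ ≤ 1 := by linarith [e1, pow_one τ, pow_zero τ]
  intro p hp q hq hp1 hp2 hpq hch
  have np : ∀ i, ‖p i‖ ≤ C * τ ^ 30 := fun i => (c3_coord_le p i).trans hp2
  have t30 : 0 < τ ^ 30 := pow_pos hτ _
  have t39 : 0 < τ ^ 39 := pow_pos hτ _
  have hCt : 0 < C * τ ^ 30 := mul_pos hC0 t30
  obtain ⟨T, hT⟩ : ∃ T : ℝ, T = 2 * C * τ ^ 30 := ⟨_, rfl⟩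
  obtain ⟨d, hd⟩ : ∃ d : ℝ, d = C * τ ^ 39 := ⟨_, rfl⟩
  have hd0 : 0 < d := by rw [hd]; exact mul_pos hC0 t39
  have hdT : 20 * d ≤ C * τ ^ 30 := by rw [hd]; linarith
  have npT : ∀ i, ‖p i‖ + 20 * d ≤ T := fun i => by rw [hT]; linarith [np i]
  obtain ⟨S, hS⟩ : ∃ S : ℝ, S = ‖p 1‖ ^ 4 + ‖p 2‖ ^ 2 * T ^ 2 + (20 * d) ^ 2 * T ^ 2 := ⟨_, rfl⟩
  by_cases hbig : 1204 * (20 * d) * S ≤ 2 * ‖p 2‖ ^ 4 * ‖p 0‖ ∨ 1204 * (20 * d) * S ≤ 6 * ‖p 1‖ ^ 5 ∨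
      1204 * (20 * d) * S ≤ 4 * ‖p 2‖ ^ 3 * ‖p 0‖ ^ 2
  · refine (smooth1 hp hq hd0 npT ?_ (hpq.trans hd.ge) hS hbig (ε := ε * τ ^ 39)
      (mul_pos hε t39)).mono ?_ le_rfl
    · calc 15309 * T ^ 4 = 15309 * (2 * C) ^ 4 * τ ^ 120 := by rw [hT]; ring
        _ ≤ _ := e2.le
        _ = _ := by rw [hd]; ring
    · refine Set.inter_subset_inter_right _ (Metric.closedBall_subset_closedBall ?_)
      have : 0 < (2 * C + ε) * τ ^ 39 := by positivity
      rw [hd]; linarith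
  · push Not at hbig
    obtain ⟨b1, b2, b3⟩ := hbig
    have hF := mem_XOne.1 hp
    have l7 : (p 0 + p 1 + p 2) ^ 7 = p 2 ^ 4 * p 0 ^ 2 - p 1 ^ 6 := by
      simp only [FO] at hF; linear_combination hF
    have l7n : ‖p 0 + p 1 + p 2‖ ^ 7 ≤ ‖p 1‖ ^ 6 + ‖p 2‖ ^ 4 * ‖p 0‖ ^ 2 := by
      rw [← norm_pow, l7]
      refine (norm_sub_le _ _).trans (le_of_eq ?_)
      simp only [norm_mul, norm_pow]; ring
    have hκC : κ * (2 * C) = 1 / C := by rw [hκe]; field_simp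
    have hdi := dicho (κ := κ) (B := 1204) (r := 20 * d) (T := T) (X := ‖p 0‖) (Y := ‖p 1‖)
      (Z := ‖p 2‖) (l := ‖p 0 + p 1 + p 2‖) (A2 := A2) (A3 := A3) hκ (by norm_num) (by positivity)
      (by rw [hT]; linarith) (norm_nonneg _) (norm_nonneg _) (norm_nonneg _)
      (by linarith [npT 0]) (by linarith [npT 1]) (by linarith [npT 2])
      (by
        have := c3_norm_le p
        calc κ * T = κ * (2 * C) * τ ^ 30 := by rw [hT]; ring
          _ = τ ^ 30 / C := by rw [hκC]; ring
          _ ≤ _ := hp1.trans this)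
      (by
        have h1 := norm_sub_le (p 0 + p 1 + p 2) (p 1 + p 2)
        have h2 := norm_add_le (p 1) (p 2)
        have h3 : p 0 + p 1 + p 2 - (p 1 + p 2) = p 0 := by ring
        rw [h3] at h1; linarith)
      l7n hS b1 b2 b3 hA2 hA3
      (by
        calc _ = 3 * 1204 * (20 * C) * (2 * C) ^ 4 * τ ^ 159 := by rw [hT, hd]; ring
          _ ≤ _ := e4.le
          _ = _ := by rw [hT]; ring)
      (by
        calc _ = 2 * (1204 / 3 * (20 * C)) ^ 6 * τ ^ 234 := by rw [hd]; ring
          _ ≤ _ := e5.le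
          _ = _ := by rw [hT]; ring)
      (by
        calc _ = 2 * (A2 ^ 4 * (20 * C) ^ 4 * (2 * C) ^ 2) * τ ^ 216 := by rw [hT, hd]; ring
          _ ≤ _ := e6.le
          _ = _ := by rw [hT]; ring)
      (by
        calc _ = A3 ^ 6 * (20 * C) ^ 18 * (2 * C) ^ 12 * τ ^ 1062 := by rw [hT, hd]; ring
          _ < _ := e7
          _ = _ := by rw [hT]; ring)
    obtain ⟨hz, hx⟩ := hdi
    have hz0 : c * τ ^ 30 ≤ ‖p 2‖ := by
      refine le_trans (le_of_eq ?_) hz; rw [hce, hT]; ring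
    have hx0 : ‖p 0‖ ≤ A * τ ^ 39 := by
      refine hx.trans (le_of_eq ?_); rw [hAe, hd]; ring
    have hl3 : ‖p 0 + p 1 + p 2‖ ≤ 3 * C * τ ^ 30 := by
      refine (norm_add₃_le).trans ?_
      linarith [np 0, np 1, np 2]
    have hy6 : ‖p 1‖ ^ 6 ≤ (D * τ ^ 33) ^ 6 := by
      have y6 : p 1 ^ 6 = p 2 ^ 4 * p 0 ^ 2 - (p 0 + p 1 + p 2) ^ 7 := by rw [l7]; ring
      have t1 : τ ^ 210 ≤ τ ^ 198 := pow_le_pow_of_le_one hτ.le hτ1 (by norm_num)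
      have t198 : 0 < τ ^ 198 := pow_pos hτ _
      have hDD : D ≤ D ^ 6 := le_self_pow₀ (by linarith) (by norm_num)
      calc ‖p 1‖ ^ 6 = ‖p 2 ^ 4 * p 0 ^ 2 - (p 0 + p 1 + p 2) ^ 7‖ := by rw [← norm_pow, y6]
        _ ≤ ‖p 2‖ ^ 4 * ‖p 0‖ ^ 2 + ‖p 0 + p 1 + p 2‖ ^ 7 := by
          refine (norm_sub_le _ _).trans (le_of_eq ?_)
          simp only [norm_mul, norm_pow]
        _ ≤ (C * τ ^ 30) ^ 4 * (A * τ ^ 39) ^ 2 + (3 * C * τ ^ 30) ^ 7 := by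
          gcongr; exact np 2
        _ = C ^ 4 * A ^ 2 * τ ^ 198 + (3 * C) ^ 7 * τ ^ 210 := by ring
        _ ≤ C ^ 4 * A ^ 2 * τ ^ 198 + (3 * C) ^ 7 * τ ^ 198 := by gcongr
        _ = (C ^ 4 * A ^ 2 + (3 * C) ^ 7) * τ ^ 198 := by ring
        _ ≤ D ^ 6 * τ ^ 198 := by
          gcongr; refine le_trans ?_ hDD; rw [hDe]; linarith
        _ = _ := by ring
    have hy0 : ‖p 1‖ ≤ D * τ ^ 33 :=
      le_of_pow_le_pow_left₀ (by norm_num) (mul_nonneg hD0.le (pow_nonneg hτ.le _)) hy6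
    have hx' := xclose hτ hτ1 hC hCD hc hA (η := θ / (12 * C ^ 2)) (by positivity) hp hp2 hy0 hx0 hz0 hpq hch
      (ε := ε / 4) (by positivity) hθ (by rw [mul_div_cancel₀]; positivity) s1 s2 s3 s6 s7
    refine (seg_chain t39 hC hε hp hq hpq hx' ?_).mono ?_ le_rfl
    · intro y z hy hz
      exact root3 hτ hτ1 hC hCD hc hA (np 0) (np 1) (np 2) hy0 hx0 hz0 hF (by positivity)
        (by linarith) hy hz s1 s2 s3 s4 s5
    · refine Set.inter_subset_inter_right _ (Metric.closedBall_subset_closedBall ?_)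
      have : 0 < 20 * C * τ ^ 39 := by positivity
      linarith

lemma cball_sub {U : Set C3} {r R : ℝ} {p : C3} (hU : Metric.ball (0 : C3) r ⊆ U) (h : ‖p‖ + R < r) :
    Metric.closedBall p R ⊆ U := by
  intro u hu
  apply hU
  rw [mem_closedBall_iff_norm] at hu
  rw [mem_ball_zero_iff]
  have := norm_add_le (u - p) p
  rw [sub_add_cancel] at this
  linarith

lemma outer_core {U₁ U₂ : Set C3} (hU1 : IsOpen U₁) (hU2 : IsOpen U₂) (z1 : (0 : C3) ∈ U₁)
    (z2 : (0 : C3) ∈ U₂) {f g : C3 → C3} {K : ℝ} (hK : 1 ≤ K)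
    (hf : ∀ b ∈ XTwo ∩ U₂, f b ∈ XOne ∩ U₁) (hg : ∀ a ∈ XOne ∩ U₁, g a ∈ XTwo ∩ U₂)
    (hgf : ∀ b ∈ XTwo ∩ U₂, g (f b) = b)
    (hfL : ∀ a ∈ XTwo ∩ U₂, ∀ b ∈ XTwo ∩ U₂, ‖f a - f b‖ ≤ K * ‖a - b‖)
    (hgL : ∀ a ∈ XOne ∩ U₁, ∀ b ∈ XOne ∩ U₁, ‖g a - g b‖ ≤ K * ‖a - b‖)
    (f0 : f 0 = 0) (g0 : g 0 = 0) : False := by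
  have hK0 : 0 < K := by linarith
  obtain ⟨r1, hr1, hb1⟩ := Metric.isOpen_iff.1 hU1 0 z1
  obtain ⟨r2, hr2, hb2⟩ := Metric.isOpen_iff.1 hU2 0 z2
  have o1 : (0 : C3) ∈ XOne ∩ U₁ := ⟨by rw [mem_XOne]; simp [FO], z1⟩
  have o2 : (0 : C3) ∈ XTwo ∩ U₂ := ⟨by rw [mem_XTwo]; simp [FT], z2⟩
  obtain ⟨M, η0, hM, hη0, hev⟩ := M1 (C := 100 * K) (ε := 1 / (8 * K)) (by linarith) (by positivity)
    (by rw [div_le_one (by positivity)]; linarith)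
  have hKM : 1 ≤ K * M := one_le_mul_of_one_le_of_one_le hK hM
  obtain ⟨τ, hτ, hM1, e0, e1, e2, e3⟩ := (Filter.Eventually.and (self_mem_nhdsWithin (a := (0 : ℝ)) (s := Set.Ioi (0 : ℝ))) <| hev.and <|
    (ev_lt 1 (c' := 1) one_pos (m := 1) (n := 0) (by norm_num)).and <|
    (ev_lt 104 hr2 (m := 30) (n := 0) (by norm_num)).and <|
    (ev_lt (4 * K + M) hr1 (m := 30) (n := 0) (by norm_num)).and
    (ev_lt (100000000 * (K * M) ^ 4) one_pos (m := 1) (n := 0) (by norm_num))).exists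
  have hτ : 0 < τ := hτ
  rw [pow_zero, mul_one] at e0 e1 e2 e3
  rw [pow_one] at e3 e0
  have hτ1 : τ ≤ 1 := by linarith
  obtain ⟨p, hp, q, hq, p1, p2, pq, hch, hno⟩ := M2 hKM hτ e3.le
  have q1 : τ ^ 38 ≤ τ ^ 30 := pow_le_pow_of_le_one hτ.le hτ1 (by norm_num)
  have q2 : τ ^ 39 ≤ τ ^ 38 := pow_le_pow_of_le_one hτ.le hτ1 (by norm_num)
  have t39 : 0 < τ ^ 39 := pow_pos hτ _
  have t38 : 0 < τ ^ 38 := pow_pos hτ _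
  have t30 : 0 < τ ^ 30 := pow_pos hτ _
  have s2 : Metric.closedBall p (100 * τ ^ 38) ⊆ U₂ := cball_sub hb2 (by linarith)
  have hpA : p ∈ XTwo ∩ U₂ := ⟨hp, s2 (by simp; positivity)⟩
  have hqA : q ∈ XTwo ∩ U₂ := ⟨hq, s2 (by rw [mem_closedBall_iff_norm, norm_sub_rev]; linarith)⟩
  have fp : ‖f p‖ ≤ K * ‖p‖ := by simpa [f0] using hfL p hpA 0 o2
  have gp : ‖p‖ ≤ K * ‖f p‖ := by simpa [g0, hgf p hpA] using hgL (f p) (hf p hpA) 0 o1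
  have fpq : ‖f q - f p‖ ≤ K * ‖p - q‖ := by rw [norm_sub_rev p]; exact hfL q hqA p hpA
  have c1 : Chn ((XTwo ∩ U₂) ∩ Metric.closedBall p (100 * τ ^ 38)) (η0 * τ ^ 39 / K) p q :=
    (hch _ (by positivity)).mono (fun u hu => ⟨⟨hu.1, s2 hu.2⟩, hu.2⟩) le_rfl
  have c2 := c1.map hK0.le hpA hf hfL
  have fpb : ‖f p‖ ≤ 4 * K * τ ^ 30 := fp.trans (by nlinarith)
  have c3 := hM1 (f p) (hf p hpA).1 (f q) (hf q hqA).1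
    (by
      rw [div_le_iff₀ (by positivity)]
      nlinarith [norm_nonneg (f p)])
    (by nlinarith) (by nlinarith)
    (c2.mono (fun u hu => ⟨hu.1.1, by
      have := hu.2; rwa [show K * (100 * τ ^ 38) = 100 * K * τ ^ 38 by ring] at this⟩)
      (le_of_eq (by field_simp)))
  have s1 : Metric.closedBall (f p) (M * τ ^ 39) ⊆ U₁ := cball_sub hb1 (by
    have : M * τ ^ 39 ≤ M * τ ^ 30 := mul_le_mul_of_nonneg_left (q2.trans q1) (by linarith)
    linarith)
  have c4 : Chn ((XOne ∩ U₁) ∩ Metric.closedBall (f p) (M * τ ^ 39)) (1 / (8 * K) * τ ^ 39) (f p) (f q) :=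
    c3.mono (fun u hu => ⟨⟨hu.1, s1 hu.2⟩, hu.2⟩) le_rfl
  have c5 := c4.map hK0.le (hf p hpA) hg hgL
  rw [hgf p hpA, hgf q hqA] at c5
  refine hno (c5.mono (fun u hu => ⟨hu.1.1, ?_⟩) (le_of_eq (by field_simp)))
  have := hu.2
  rwa [← mul_assoc] at this

open Classical in
lemma not_same_outer : ¬ SameOuterLipschitzGeometry XOne XTwo := by
  rintro ⟨U₁, U₂, hU1, hU2, z1, z2, φ, hφ0, K, hK, hL⟩
  have hK0 : 0 < K := by linarith
  have o1 : (0 : C3) ∈ XOne ∩ U₁ := ⟨by rw [mem_XOne]; simp [FO], z1⟩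
  have o2 : (0 : C3) ∈ XTwo ∩ U₂ := ⟨by rw [mem_XTwo]; simp [FT], z2⟩
  have p0 : φ ⟨0, o1⟩ = ⟨0, o2⟩ := Subtype.ext (hφ0 ⟨0, o1⟩ rfl)
  refine outer_core hU1 hU2 z1 z2
    (f := fun b => if h : b ∈ XTwo ∩ U₂ then (φ.symm ⟨b, h⟩ : C3) else 0)
    (g := fun a => if h : a ∈ XOne ∩ U₁ then (φ ⟨a, h⟩ : C3) else 0) hK ?_ ?_ ?_ ?_ ?_ ?_ ?_
  · intro b hb
    simp only [dif_pos hb]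
    exact (φ.symm ⟨b, hb⟩).2
  · intro b hb
    simp only [dif_pos hb]
    exact (φ ⟨b, hb⟩).2
  · intro b hb
    simp only [dif_pos hb]
    rw [dif_pos (φ.symm ⟨b, hb⟩).2]
    simp
  · intro a ha b hb
    simp only [dif_pos ha, dif_pos hb]
    have := (hL (φ.symm ⟨a, ha⟩) (φ.symm ⟨b, hb⟩)).1
    simp only [Homeomorph.apply_symm_apply] at this
    rwa [one_div, inv_mul_le_iff₀ hK0] at this
  · intro a ha b hb
    simp only [dif_pos ha, dif_pos hb]
    exact (hL ⟨a, ha⟩ ⟨b, hb⟩).2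
  · simp only [dif_pos o2]
    rw [← p0]; simp
  · simp only [dif_pos o1]
    rw [p0]


/-- **Theorem 1.2 (ii).** `(X₁,0)` and `(X₂,0)` are superisolated singularities whose
projectivized tangent cones have the same combinatorial type, yet they do not have the
same outer Lipschitz geometry. -/
theorem same_combinatorial_type_different_outer_geometry :
    IsSIS XOne fOne gSeven 6 ∧ IsSIS XTwo fTwo gSeven 6 ∧
    SameCombinatorialType (projCurve fOne) (projCurve fTwo) ∧
    ¬ SameOuterLipschitzGeometry XOne XTwo := by
  exact ⟨sis_one, sis_two, same_comb, not_same_outer⟩
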